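/- liminf_{n→∞} I(x*;Y)/n ≥ inf_{m∈ℝ} i_L(m). -/

import Mathlib

open MeasureTheory ProbabilityTheory Filter Real

noncomputable section

/-- Index set of pairs `1 ≤ i ≤ j ≤ n`. -/
abbrev SymIdx (n : ℕ) := {q : Fin n × Fin n // q.1 ≤ q.2}

/-- Kullback–Leibler divergence, expressed as the integral of the log-likelihood ratio. -/
def klDivR {α : Type*} [MeasurableSpace α] (μ ν : Measure α) : ℝ := ∫ a, llr μ ν a ∂μ

/-- Mutual information of a joint law on a product space: the KL divergence between the
joint law and the product of its marginals. -/
def mutualInfoR {α β : Type*} [MeasurableSpace α] [MeasurableSpace β]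
    (μ : Measure (α × β)) : ℝ := klDivR μ (μ.fst.prod μ.snd)

/-- Joint law of `(x*, Y)` for the Gaussian channel `Y_{ij} = x*_i x*_j/√n + √Δ ξ_{ij}`,
where `x*` has i.i.d. coordinates of law `p` and `ξ` is i.i.d. standard Gaussian. -/
def gaussJoint (p : Measure ℝ) (Δ : ℝ) (n : ℕ) :
    Measure ((Fin n → ℝ) × (SymIdx n → ℝ)) :=
  ((Measure.pi fun _ : Fin n => p).prod
      (Measure.pi fun _ : SymIdx n => gaussianReal 0 1)).map
    (fun w => (w.1, fun q : SymIdx n =>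
      w.1 q.1.1 * w.1 q.1.2 / Real.sqrt n + Real.sqrt Δ * w.2 q))

/-- The mutual information `I(x*; Y)` for the Gaussian channel. -/
def MI (p : Measure ℝ) (Δ : ℝ) (n : ℕ) : ℝ := mutualInfoR (gaussJoint p Δ n)

/-- `J(A,B) = log ∫ exp(Bx - A x²/2) p(dx)`. -/
def Jf (p : Measure ℝ) (A B : ℝ) : ℝ := Real.log (∫ x, Real.exp (B * x - A * x ^ 2 / 2) ∂p)

/-- The Bethe mutual information `i_B(m)`. -/
def iB (p : Measure ℝ) (Δ m : ℝ) : ℝ :=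
  (m ^ 2 + (∫ x, x ^ 2 ∂p) ^ 2) / (4 * Δ)
    - ∫ w : ℝ × ℝ, Jf p (m / Δ) (m * w.1 / Δ + Real.sqrt (m / Δ) * w.2)
        ∂(p.prod (gaussianReal 0 1))

/-- The lower-bound functional `i_L(m)` built from a minimizer `m̂` of `i_B`. -/
def iL (p : Measure ℝ) (Δ mhat m : ℝ) : ℝ :=
  (2 * m ^ 2 - mhat ^ 2 + (∫ x, x ^ 2 ∂p) ^ 2) / (4 * Δ)
    - ∫ w : ℝ × ℝ, Jf p (mhat / Δ) (m * w.1 / Δ + Real.sqrt (mhat / Δ) * w.2)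
        ∂(p.prod (gaussianReal 0 1))

theorem hasDerivAt_gaussianPDFReal_std (x : ℝ) :
    HasDerivAt (gaussianPDFReal 0 1) (-x * gaussianPDFReal 0 1 x) x := by
  unfold gaussianPDFReal
  have h : HasDerivAt (fun x : ℝ => -(x - 0) ^ 2 / (2 * ((1 : NNReal) : ℝ))) (-x) x := by
    have := ((hasDerivAt_id x).pow 2).const_mul (-1/2 : ℝ)
    refine (this.congr_deriv ?_).congr_of_eventuallyEq ?_
    · simp; ring
    · exact Eventually.of_forall fun y => by simp; ring
  refine (h.exp.const_mul _).congr_deriv ?_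
  ring

theorem integral_gaussian_ibp {f f' : ℝ → ℝ} {C C' : ℝ} (hf : ∀ x, HasDerivAt f (f' x) x)
    (hb : ∀ x, |f x| ≤ C) (hb' : ∀ x, |f' x| ≤ C') :
    ∫ x, x * f x ∂(gaussianReal 0 1) = ∫ x, f' x ∂(gaussianReal 0 1) := by
  have hfc : Continuous f := continuous_iff_continuousAt.2 fun x => (hf x).continuousAt
  have hf'm : Measurable f' := by
    have : f' = deriv f := funext fun x => (hf x).deriv.symm
    rw [this]; exact measurable_deriv f
  have hid : Integrable (fun x : ℝ => x * gaussianPDFReal 0 1 x) := by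
    have h : Integrable (fun x : ℝ => x) (gaussianReal 0 1) :=
      (memLp_id_gaussianReal (μ := 0) (v := 1) 1).integrable (by simp)
    rw [gaussianReal_of_var_ne_zero 0 one_ne_zero,
      integrable_withDensity_iff_integrable_smul' (measurable_gaussianPDF 0 1)
      (Eventually.of_forall fun x => gaussianPDF_lt_top)] at h
    simpa [toReal_gaussianPDF, mul_comm] using h
  have hu'v : Integrable (f' * gaussianPDFReal 0 1) :=
    (integrable_gaussianPDFReal 0 1).bdd_mul (c := C') hf'm.aestronglyMeasurable
      (Eventually.of_forall hb')
  have huv : Integrable (f * gaussianPDFReal 0 1) :=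
    (integrable_gaussianPDFReal 0 1).bdd_mul (c := C) hfc.aestronglyMeasurable
      (Eventually.of_forall hb)
  have huv' : Integrable (f * fun x => -x * gaussianPDFReal 0 1 x) := by
    have := hid.neg.bdd_mul (c := C) hfc.aestronglyMeasurable (Eventually.of_forall hb)
    refine this.congr (Eventually.of_forall fun x => ?_)
    simp
  have key := integral_mul_deriv_eq_deriv_mul_of_integrable (fun x _ => hf x)
    (fun x _ => hasDerivAt_gaussianPDFReal_std x)
    huv' hu'v huv
  rw [integral_gaussianReal_eq_integral_smul one_ne_zero,
    integral_gaussianReal_eq_integral_smul one_ne_zero]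
  have e1 : (fun x => gaussianPDFReal 0 1 x • (x * f x))
      = fun x => -(f x * (-x * gaussianPDFReal 0 1 x)) := by funext x; simp; ring
  rw [e1, integral_neg, key, neg_neg]
  simp [mul_comm]

section
variable {ι : Type*} [Fintype ι] [DecidableEq ι]

theorem measurePreserving_update (μ : ι → Measure ℝ) [∀ i, IsProbabilityMeasure (μ i)] (a : ι) :
    MeasurePreserving (fun w : (ι → ℝ) × ℝ => Function.update w.1 a w.2)
      ((Measure.pi μ).prod (μ a)) (Measure.pi μ) := by
  have hm : Measurable (fun w : (ι → ℝ) × ℝ => Function.update w.1 a w.2) := by fun_prop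
  refine ⟨hm, (Measure.pi_eq fun s hs => ?_).symm⟩
  rw [Measure.map_apply hm (MeasurableSet.univ_pi hs)]
  have : (fun w : (ι → ℝ) × ℝ => Function.update w.1 a w.2) ⁻¹' (Set.univ.pi s)
      = (Set.univ.pi (Function.update s a Set.univ)) ×ˢ (s a) := by
    ext w
    simp only [Set.mem_preimage, Set.mem_pi, Set.mem_univ, true_implies, Set.mem_prod]
    constructor
    · intro h
      refine ⟨fun i => ?_, by simpa using h a⟩
      by_cases hi : i = a
      · subst hi; simp
      · simpa [hi] using h i
    · rintro ⟨h, h2⟩ i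
      by_cases hi : i = a
      · subst hi; simpa using h2
      · simpa [hi] using h i
  rw [this, Measure.prod_prod, Measure.pi_pi]
  rw [← Finset.mul_prod_erase _ _ (Finset.mem_univ a),
    ← Finset.mul_prod_erase _ (fun i => μ i (s i)) (Finset.mem_univ a)]
  simp only [Function.update_self, measure_univ, one_mul]
  rw [mul_comm]
  congr 1
  exact Finset.prod_congr rfl fun i hi => by simp [Finset.ne_of_mem_erase hi]

theorem integral_pi_gaussian_ibp {f f' : (ι → ℝ) → ℝ} {C C' : ℝ} (a : ι)
    (hfm : Measurable f) (hfm' : Measurable f')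
    (hf : ∀ g z, HasDerivAt (fun z => f (Function.update g a z)) (f' (Function.update g a z)) z)
    (hb : ∀ x, |f x| ≤ C) (hb' : ∀ x, |f' x| ≤ C') :
    ∫ g, g a * f g ∂(Measure.pi fun _ : ι => gaussianReal 0 1)
      = ∫ g, f' g ∂(Measure.pi fun _ : ι => gaussianReal 0 1) := by
  have mp := measurePreserving_update (fun _ : ι => gaussianReal 0 1) a
  have hfi : Integrable (fun g : ι → ℝ => g a * f g)
      (Measure.pi fun _ : ι => gaussianReal 0 1) := by
    have h1 : Integrable (fun g : ι → ℝ => g a) (Measure.pi fun _ : ι => gaussianReal 0 1) :=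
      integrable_eval ((memLp_id_gaussianReal (μ := 0) (v := 1) 1).integrable (by simp))
    exact h1.mul_bdd (c := C) hfm.aestronglyMeasurable (Eventually.of_forall hb)
  have hfi' : Integrable f' (Measure.pi fun _ : ι => gaussianReal 0 1) :=
    Integrable.of_bound hfm'.aestronglyMeasurable C' (Eventually.of_forall hb')
  have i1 : Integrable (fun w : (ι → ℝ) × ℝ => Function.update w.1 a w.2 a *
      f (Function.update w.1 a w.2)) _ := mp.integrable_comp hfi.aestronglyMeasurable |>.2 hfi
  have i2 : Integrable (fun w : (ι → ℝ) × ℝ => f' (Function.update w.1 a w.2)) _ :=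
    mp.integrable_comp hfi'.aestronglyMeasurable |>.2 hfi'
  conv_lhs => rw [← mp.map_eq]
  conv_rhs => rw [← mp.map_eq]
  rw [integral_map mp.aemeasurable (by rw [mp.map_eq]; exact hfi.aestronglyMeasurable),
    integral_map mp.aemeasurable (by rw [mp.map_eq]; exact hfi'.aestronglyMeasurable),
    integral_prod _ i1, integral_prod _ i2]
  refine integral_congr_ae (Eventually.of_forall fun g => ?_)
  simp only [Function.update_self]
  exact integral_gaussian_ibp (fun z => hf g z) (fun z => hb _) (fun z => hb' _)
end

section LogSumExp
variable {κ : Type*}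

/-- The weighted log-sum-exp `log ∑_{σ ∈ S} w σ exp (E σ)`. -/
def lse (S : Finset κ) (w E : κ → ℝ) : ℝ := Real.log (∑ σ ∈ S, w σ * Real.exp (E σ))

/-- The average of `f` under the Gibbs weights `w σ exp (E σ)` on `S`. -/
def gibbs (S : Finset κ) (w E f : κ → ℝ) : ℝ :=
  (∑ σ ∈ S, w σ * Real.exp (E σ) * f σ) / ∑ σ ∈ S, w σ * Real.exp (E σ)

variable {S : Finset κ} {w : κ → ℝ}

theorem sum_mul_exp_pos (hw : ∀ σ ∈ S, 0 ≤ w σ) (hpos : 0 < ∑ σ ∈ S, w σ) (E : κ → ℝ) :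
    0 < ∑ σ ∈ S, w σ * Real.exp (E σ) := by
  obtain ⟨σ, hσ, h⟩ := Finset.exists_lt_of_sum_lt (s := S) (f := fun _ => 0) (g := w) (by simpa)
  exact Finset.sum_pos' (fun τ hτ => mul_nonneg (hw τ hτ) (Real.exp_pos _).le)
    ⟨σ, hσ, mul_pos h (Real.exp_pos _)⟩

theorem abs_gibbs_le (hw : ∀ σ ∈ S, 0 ≤ w σ) (hpos : 0 < ∑ σ ∈ S, w σ) {E f : κ → ℝ} {C : ℝ}
    (hf : ∀ σ ∈ S, |f σ| ≤ C) : |gibbs S w E f| ≤ C := by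
  have hZ := sum_mul_exp_pos hw hpos E
  rw [gibbs, abs_div, abs_of_pos hZ, div_le_iff₀ hZ, Finset.mul_sum]
  refine (Finset.abs_sum_le_sum_abs _ _).trans (Finset.sum_le_sum fun σ hσ => ?_)
  have h0 : 0 ≤ w σ * Real.exp (E σ) := mul_nonneg (hw σ hσ) (Real.exp_pos _).le
  rw [abs_mul, abs_of_nonneg h0, mul_comm C]
  exact mul_le_mul_of_nonneg_left (hf σ hσ) h0

theorem gibbs_sum {ι : Type*} (t : Finset ι) (E : κ → ℝ) (f : ι → κ → ℝ) :
    gibbs S w E (fun σ => ∑ a ∈ t, f a σ) = ∑ a ∈ t, gibbs S w E (f a) := by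
  simp only [gibbs, Finset.mul_sum]
  rw [Finset.sum_comm, Finset.sum_div]

theorem gibbs_const_mul (E : κ → ℝ) (c : ℝ) (f : κ → ℝ) :
    gibbs S w E (fun σ => c * f σ) = c * gibbs S w E f := by
  simp only [gibbs, ← mul_div_assoc, Finset.mul_sum]
  congr 1
  exact Finset.sum_congr rfl fun σ _ => by ring

theorem gibbs_sub (E f g : κ → ℝ) :
    gibbs S w E (fun σ => f σ - g σ) = gibbs S w E f - gibbs S w E g := by
  simp only [gibbs, mul_sub, Finset.sum_sub_distrib, sub_div]

theorem abs_lse_le (hw : ∀ σ ∈ S, 0 ≤ w σ) (hpos : 0 < ∑ σ ∈ S, w σ) {E : κ → ℝ} {B : ℝ}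
    (hE : ∀ σ ∈ S, |E σ| ≤ B) : |lse S w E| ≤ |Real.log (∑ σ ∈ S, w σ)| + B := by
  have hZ := sum_mul_exp_pos hw hpos E
  have h1 : ∑ σ ∈ S, w σ * Real.exp (E σ) ≤ (∑ σ ∈ S, w σ) * Real.exp B := by
    rw [Finset.sum_mul]
    exact Finset.sum_le_sum fun σ hσ => mul_le_mul_of_nonneg_left
      (Real.exp_le_exp.2 ((le_abs_self _).trans (hE σ hσ))) (hw σ hσ)
  have h2 : (∑ σ ∈ S, w σ) * Real.exp (-B) ≤ ∑ σ ∈ S, w σ * Real.exp (E σ) := by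
    rw [Finset.sum_mul]
    exact Finset.sum_le_sum fun σ hσ => mul_le_mul_of_nonneg_left
      (Real.exp_le_exp.2 (neg_le_of_abs_le (hE σ hσ))) (hw σ hσ)
  have h3 := Real.log_le_log hZ h1
  have h4 := Real.log_le_log (by positivity) h2
  rw [Real.log_mul hpos.ne' (Real.exp_pos _).ne', Real.log_exp] at h3 h4
  rw [lse, abs_le]
  constructor
  · linarith [neg_abs_le (Real.log (∑ σ ∈ S, w σ))]
  · linarith [le_abs_self (Real.log (∑ σ ∈ S, w σ))]

theorem hasDerivAt_sum_mul_exp {E : ℝ → κ → ℝ} {E' : κ → ℝ} {s : ℝ}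
    (hE : ∀ σ ∈ S, HasDerivAt (fun s => E s σ) (E' σ) s) (f : κ → ℝ) :
    HasDerivAt (fun s => ∑ σ ∈ S, w σ * Real.exp (E s σ) * f σ)
      (∑ σ ∈ S, w σ * Real.exp (E s σ) * (f σ * E' σ)) s := by
  refine HasDerivAt.fun_sum fun σ hσ => ?_
  refine (((hE σ hσ).exp.const_mul (w σ)).mul_const (f σ)).congr_deriv ?_
  ring

theorem hasDerivAt_lse (hw : ∀ σ ∈ S, 0 ≤ w σ) (hpos : 0 < ∑ σ ∈ S, w σ) {E : ℝ → κ → ℝ}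
    {E' : κ → ℝ} {s : ℝ} (hE : ∀ σ ∈ S, HasDerivAt (fun s => E s σ) (E' σ) s) :
    HasDerivAt (fun s => lse S w (E s)) (gibbs S w (E s) E') s := by
  have h := hasDerivAt_sum_mul_exp (w := w) hE (fun _ => 1)
  simp only [mul_one, one_mul] at h
  exact h.log (sum_mul_exp_pos hw hpos _).ne'

theorem hasDerivAt_gibbs (hw : ∀ σ ∈ S, 0 ≤ w σ) (hpos : 0 < ∑ σ ∈ S, w σ) {E : ℝ → κ → ℝ}
    {E' : κ → ℝ} {s : ℝ} (hE : ∀ σ ∈ S, HasDerivAt (fun s => E s σ) (E' σ) s) (f : κ → ℝ) :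
    HasDerivAt (fun s => gibbs S w (E s) f)
      (gibbs S w (E s) (fun σ => f σ * E' σ) - gibbs S w (E s) f * gibbs S w (E s) E') s := by
  have h := hasDerivAt_sum_mul_exp (w := w) hE (fun _ => 1)
  simp only [mul_one, one_mul] at h
  have hZ := (sum_mul_exp_pos hw hpos (E s)).ne'
  refine ((hasDerivAt_sum_mul_exp (w := w) hE f).div h hZ).congr_deriv ?_
  simp only [gibbs]
  field_simp

theorem gibbs_mul_gibbs (E f g : κ → ℝ) :
    gibbs S w E f * gibbs S w E g
      = gibbs S w E (fun σ => gibbs S w E (fun τ => f σ * g τ)) := by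
  simp only [gibbs_const_mul]
  have : (fun σ => f σ * gibbs S w E g) = fun σ => gibbs S w E g * f σ := by
    funext σ; ring
  rw [this, gibbs_const_mul, mul_comm]

theorem gibbs_mono (hw : ∀ σ ∈ S, 0 ≤ w σ) (hpos : 0 < ∑ σ ∈ S, w σ) {E f g : κ → ℝ}
    (h : ∀ σ ∈ S, f σ ≤ g σ) : gibbs S w E f ≤ gibbs S w E g := by
  refine div_le_div_of_nonneg_right (Finset.sum_le_sum fun σ hσ => ?_)
    (sum_mul_exp_pos hw hpos E).le
  exact mul_le_mul_of_nonneg_left (h σ hσ) (mul_nonneg (hw σ hσ) (Real.exp_pos _).le)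

theorem gibbs_const (hw : ∀ σ ∈ S, 0 ≤ w σ) (hpos : 0 < ∑ σ ∈ S, w σ) (E : κ → ℝ) (c : ℝ) :
    gibbs S w E (fun _ => c) = c := by
  rw [gibbs, ← Finset.sum_mul]
  exact mul_div_cancel_left₀ c (sum_mul_exp_pos hw hpos E).ne'

theorem measurable_gibbs {α : Type*} [MeasurableSpace α] {E : α → κ → ℝ} {f : α → κ → ℝ}
    (hE : ∀ σ, Measurable fun x => E x σ) (hf : ∀ σ, Measurable fun x => f x σ) :
    Measurable fun x => gibbs S w (E x) (f x) := by
  unfold gibbs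
  fun_prop

theorem measurable_lse {α : Type*} [MeasurableSpace α] {E : α → κ → ℝ}
    (hE : ∀ σ, Measurable fun x => E x σ) : Measurable fun x => lse S w (E x) := by
  unfold lse
  fun_prop

end LogSumExp

section Interpolation
variable {κ ι : Type*} [Fintype ι]

/-- The compensated Gaussian field `∑ₐ (cₐ A_σa gₐ - cₐ² A_σa² / 2)`. -/
def gfield (A : κ → ι → ℝ) (c g : ι → ℝ) (σ : κ) : ℝ :=
  ∑ a, (c a * A σ a * g a - c a ^ 2 * A σ a ^ 2 / 2)

/-- The standard Gaussian measure on `ι → ℝ`. -/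
abbrev stdGauss (ι : Type*) [Fintype ι] : Measure (ι → ℝ) :=
  Measure.pi fun _ : ι => gaussianReal 0 1

theorem integrable_eval_stdGauss (a : ι) : Integrable (fun g : ι → ℝ => g a) (stdGauss ι) :=
  integrable_eval ((memLp_id_gaussianReal (μ := 0) (v := 1) 1).integrable (by simp))

variable {S : Finset κ} {w : κ → ℝ} {A : κ → ι → ℝ} {M : ℝ}

theorem measurable_gfield (A : κ → ι → ℝ) (c : ι → ℝ) (σ : κ) :
    Measurable fun g => gfield A c g σ := by
  unfold gfield
  fun_prop

theorem abs_gfield_le (hA : ∀ σ ∈ S, ∀ a, |A σ a| ≤ M) {c : ι → ℝ} (hc : ∀ a, |c a| ≤ 1)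
    (g : ι → ℝ) {σ : κ} (hσ : σ ∈ S) : |gfield A c g σ| ≤ ∑ a, (M * |g a| + M ^ 2) := by
  refine (Finset.abs_sum_le_sum_abs _ _).trans (Finset.sum_le_sum fun a _ => ?_)
  have hM : 0 ≤ M := (abs_nonneg _).trans (hA σ hσ a)
  have h1 : |c a * A σ a| ≤ M := by
    rw [abs_mul]
    calc |c a| * |A σ a| ≤ 1 * M := mul_le_mul (hc a) (hA σ hσ a) (abs_nonneg _) zero_le_one
      _ = M := one_mul M
  have h2 : |c a * A σ a * g a| ≤ M * |g a| := by
    rw [abs_mul]; exact mul_le_mul_of_nonneg_right h1 (abs_nonneg _)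
  have h3 : |c a ^ 2 * A σ a ^ 2 / 2| ≤ M ^ 2 := by
    rw [← mul_pow, abs_div, abs_pow, abs_two]
    have := pow_le_pow_left₀ (abs_nonneg _) h1 2
    have := sq_nonneg M
    linarith
  exact (abs_sub _ _).trans (add_le_add h2 h3)

theorem integrable_linear_bound (M : ℝ) :
    Integrable (fun g : ι → ℝ => ∑ a, (M * |g a| + M ^ 2)) (stdGauss ι) :=
  integrable_finsetSum _ fun a _ =>
    ((integrable_eval_stdGauss a).abs.const_mul M).add (integrable_const _)

theorem integrable_lse_gfield (hw : ∀ σ ∈ S, 0 ≤ w σ) (hpos : 0 < ∑ σ ∈ S, w σ)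
    (hA : ∀ σ ∈ S, ∀ a, |A σ a| ≤ M) {c : ι → ℝ} (hc : ∀ a, |c a| ≤ 1) :
    Integrable (fun g => lse S w (gfield A c g)) (stdGauss ι) := by
  refine ((integrable_const (|Real.log (∑ σ ∈ S, w σ)|)).add
    (integrable_linear_bound M)).mono'
    (measurable_lse fun σ => measurable_gfield A c σ).aestronglyMeasurable
    (Eventually.of_forall fun g => ?_)
  exact abs_lse_le hw hpos fun σ hσ => abs_gfield_le hA hc g hσ

theorem integral_eval_mul_gibbs [DecidableEq ι] (hw : ∀ σ ∈ S, 0 ≤ w σ)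
    (hpos : 0 < ∑ σ ∈ S, w σ) (hA : ∀ σ ∈ S, ∀ a, |A σ a| ≤ M) {c : ι → ℝ}
    (hc : ∀ a, |c a| ≤ 1) (a : ι) :
    ∫ g, g a * gibbs S w (gfield A c g) (fun σ => A σ a) ∂(stdGauss ι)
      = ∫ g, c a * (gibbs S w (gfield A c g) (fun σ => A σ a ^ 2)
          - gibbs S w (gfield A c g) (fun σ => A σ a) ^ 2) ∂(stdGauss ι) := by
  have hsq : ∀ σ ∈ S, |A σ a ^ 2| ≤ M ^ 2 := fun σ hσ => by
    rw [abs_pow]; exact pow_le_pow_left₀ (abs_nonneg _) (hA σ hσ a) 2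
  refine integral_pi_gaussian_ibp (C := M) (C' := M ^ 2 + M ^ 2) a
    (measurable_gibbs (fun σ => measurable_gfield A c σ) (fun σ => measurable_const)) ?_ ?_
    (fun g => abs_gibbs_le hw hpos fun σ hσ => hA σ hσ a) ?_
  · have h1 := measurable_gibbs (S := S) (w := w) (f := fun _ σ => A σ a ^ 2)
      (fun σ => measurable_gfield A c σ) (fun σ => measurable_const)
    have h2 := measurable_gibbs (S := S) (w := w) (f := fun _ σ => A σ a)
      (fun σ => measurable_gfield A c σ) (fun σ => measurable_const)
    fun_prop
  · intro g z
    have hE : ∀ σ ∈ S, HasDerivAt (fun z => gfield A c (Function.update g a z) σ)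
        (c a * A σ a) z := by
      intro σ _
      have : HasDerivAt (fun z => ∑ b, (c b * A σ b * Function.update g a z b
          - c b ^ 2 * A σ b ^ 2 / 2)) (∑ b, if b = a then c a * A σ a else 0) z := by
        refine HasDerivAt.fun_sum fun b _ => ?_
        by_cases hb : b = a
        · subst hb
          simpa using ((hasDerivAt_id z).const_mul (c b * A σ b)).sub_const
            (c b ^ 2 * A σ b ^ 2 / 2)
        · simp only [Function.update_of_ne hb, if_neg hb]
          exact hasDerivAt_const z _
      simpa [gfield] using this
    refine (hasDerivAt_gibbs hw hpos hE (fun σ => A σ a)).congr_deriv ?_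
    rw [gibbs_const_mul]
    have : (fun σ => A σ a * (c a * A σ a)) = fun σ => c a * A σ a ^ 2 := by
      funext σ; ring
    rw [this, gibbs_const_mul]
    ring
  · intro g
    rw [abs_mul]
    have h1 := abs_gibbs_le (E := gfield A c g) hw hpos hsq
    have h2 := abs_gibbs_le (E := gfield A c g) hw hpos fun σ hσ => hA σ hσ a
    have h3 := pow_le_pow_left₀ (abs_nonneg _) h2 2
    rw [← abs_pow] at h3
    calc _ ≤ 1 * (M ^ 2 + M ^ 2) := mul_le_mul (hc a) ((abs_sub _ _).trans (add_le_add h1 h3))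
          (abs_nonneg _) zero_le_one
      _ = _ := one_mul _

theorem hasDerivAt_integral_lse_gfield (hw : ∀ σ ∈ S, 0 ≤ w σ) (hpos : 0 < ∑ σ ∈ S, w σ)
    (hA : ∀ σ ∈ S, ∀ a, |A σ a| ≤ M) {c c' : ℝ → ι → ℝ} (hc : ∀ s a, |c s a| ≤ 1)
    (hc' : ∀ s a, |c' s a| ≤ 1) (hd : ∀ s a, HasDerivAt (fun s => c s a) (c' s a) s) (s : ℝ) :
    HasDerivAt (fun s => ∫ g, lse S w (gfield A (c s) g) ∂(stdGauss ι))
      (∫ g, -∑ a, c s a * c' s a * gibbs S w (gfield A (c s) g) (fun σ => A σ a) ^ 2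
        ∂(stdGauss ι)) s := by
  classical
  set E' : ℝ → (ι → ℝ) → κ → ℝ := fun s g σ =>
    ∑ a, (c' s a * g a * A σ a - c s a * c' s a * A σ a ^ 2) with hE'
  have hdiff : ∀ s g, HasDerivAt (fun s => lse S w (gfield A (c s) g))
      (gibbs S w (gfield A (c s) g) (E' s g)) s := by
    intro s g
    refine hasDerivAt_lse hw hpos fun σ _ => HasDerivAt.fun_sum fun a _ => ?_
    refine ((((hd s a).mul_const (A σ a)).mul_const (g a)).sub
      ((((hd s a).pow 2).mul_const (A σ a ^ 2)).div_const 2)).congr_deriv ?_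
    simp
    ring
  have hbound : ∀ s g, |gibbs S w (gfield A (c s) g) (E' s g)| ≤ ∑ a, (M * |g a| + M ^ 2) := by
    intro s g
    refine abs_gibbs_le hw hpos fun σ hσ => ?_
    refine (Finset.abs_sum_le_sum_abs _ _).trans (Finset.sum_le_sum fun a _ => ?_)
    have hM : 0 ≤ M := (abs_nonneg _).trans (hA σ hσ a)
    refine (abs_sub _ _).trans (add_le_add ?_ ?_)
    · rw [abs_mul, abs_mul, mul_comm]
      refine mul_le_mul (hA σ hσ a) ?_ (by positivity) hM
      exact mul_le_of_le_one_left (abs_nonneg _) (hc' s a)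
    · rw [abs_mul, abs_mul, abs_pow]
      have h1 := mul_le_one₀ (hc s a) (abs_nonneg _) (hc' s a)
      have h2 := pow_le_pow_left₀ (abs_nonneg _) (hA σ hσ a) 2
      calc _ ≤ 1 * M ^ 2 := mul_le_mul h1 h2 (by positivity) zero_le_one
        _ = _ := one_mul _
  have hm' : Measurable fun g => gibbs S w (gfield A (c s) g) (E' s g) :=
    measurable_gibbs (fun σ => measurable_gfield A _ σ) (fun σ => by simp only [hE']; fun_prop)
  have key := (hasDerivAt_integral_of_dominated_loc_of_deriv_le (μ := stdGauss ι) (x₀ := s)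
    (F := fun s g => lse S w (gfield A (c s) g))
    (F' := fun s g => gibbs S w (gfield A (c s) g) (E' s g)) Filter.univ_mem
    (Eventually.of_forall fun s =>
      (measurable_lse fun σ => measurable_gfield A _ σ).aestronglyMeasurable)
    (integrable_lse_gfield hw hpos hA (hc s)) hm'.aestronglyMeasurable
    (Eventually.of_forall fun g s _ => hbound s g) (integrable_linear_bound M)
    (Eventually.of_forall fun g s _ => hdiff s g)).2
  refine key.congr_deriv ?_
  have hmA : ∀ a, Measurable fun g => gibbs S w (gfield A (c s) g) (fun σ => A σ a) := fun a =>
    measurable_gibbs (fun σ => measurable_gfield A _ σ) (fun σ => measurable_const)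
  have hmA2 : ∀ a, Measurable fun g => gibbs S w (gfield A (c s) g) (fun σ => A σ a ^ 2) :=
    fun a => measurable_gibbs (fun σ => measurable_gfield A _ σ) (fun σ => measurable_const)
  have hbA : ∀ a g, |gibbs S w (gfield A (c s) g) (fun σ => A σ a)| ≤ M := fun a g =>
    abs_gibbs_le hw hpos fun σ hσ => hA σ hσ a
  have hi1 : ∀ a, Integrable (fun g => g a * gibbs S w (gfield A (c s) g) (fun σ => A σ a))
      (stdGauss ι) := fun a =>
    (integrable_eval_stdGauss a).mul_bdd (c := M) (hmA a).aestronglyMeasurable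
      (Eventually.of_forall (hbA a))
  have hi2 : ∀ a, Integrable (fun g => gibbs S w (gfield A (c s) g) (fun σ => A σ a ^ 2))
      (stdGauss ι) := fun a =>
    Integrable.of_bound (hmA2 a).aestronglyMeasurable (M ^ 2) (Eventually.of_forall fun g => by
      refine abs_gibbs_le hw hpos fun σ hσ => ?_
      rw [abs_pow]; exact pow_le_pow_left₀ (abs_nonneg _) (hA σ hσ a) 2)
  have hi3 : ∀ a, Integrable (fun g => gibbs S w (gfield A (c s) g) (fun σ => A σ a) ^ 2)
      (stdGauss ι) := fun a =>
    Integrable.of_bound ((hmA a).pow_const 2).aestronglyMeasurable (M ^ 2)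
      (Eventually.of_forall fun g => by
        rw [norm_pow]; exact pow_le_pow_left₀ (abs_nonneg _) (hbA a g) 2)
  have e1 : ∀ g, gibbs S w (gfield A (c s) g) (E' s g)
      = ∑ a, (c' s a * (g a * gibbs S w (gfield A (c s) g) (fun σ => A σ a))
          - c s a * c' s a * gibbs S w (gfield A (c s) g) (fun σ => A σ a ^ 2)) := by
    intro g
    simp only [hE', gibbs_sum]
    refine Finset.sum_congr rfl fun a _ => ?_
    rw [gibbs_sub, gibbs_const_mul, gibbs_const_mul]
    ring
  simp only [e1, ← Finset.sum_neg_distrib]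
  have hi4 : ∀ a ∈ Finset.univ, Integrable (fun g =>
      c' s a * (g a * gibbs S w (gfield A (c s) g) (fun σ => A σ a))
        - c s a * c' s a * gibbs S w (gfield A (c s) g) (fun σ => A σ a ^ 2)) (stdGauss ι) :=
    fun a _ => ((hi1 a).const_mul _).sub ((hi2 a).const_mul _)
  have hi5 : ∀ a ∈ Finset.univ, Integrable (fun g =>
      -(c s a * c' s a * gibbs S w (gfield A (c s) g) (fun σ => A σ a) ^ 2)) (stdGauss ι) :=
    fun a _ => ((hi3 a).const_mul _).neg
  rw [integral_finsetSum _ hi4, integral_finsetSum _ hi5]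
  refine Finset.sum_congr rfl fun a _ => ?_
  rw [integral_sub ((hi1 a).const_mul _) ((hi2 a).const_mul _), integral_const_mul,
    integral_eval_mul_gibbs hw hpos hA (hc s) a, integral_const_mul, integral_const_mul,
    integral_sub (hi2 a) (hi3 a), integral_neg, integral_const_mul]
  ring

end Interpolation

section Comparison
variable {κ α β : Type*} [Fintype α] [Fintype β]

theorem measurePreserving_comp_inl :
    MeasurePreserving (fun g : α ⊕ β → ℝ => g ∘ Sum.inl) (stdGauss (α ⊕ β)) (stdGauss α) := by
  have hm : Measurable (fun g : α ⊕ β → ℝ => g ∘ Sum.inl) :=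
    measurable_pi_lambda _ fun a => measurable_pi_apply _
  refine ⟨hm, (Measure.pi_eq fun s hs => ?_).symm⟩
  rw [Measure.map_apply hm (MeasurableSet.univ_pi hs)]
  have : (fun g : α ⊕ β → ℝ => g ∘ Sum.inl) ⁻¹' (Set.univ.pi s)
      = Set.univ.pi (Sum.elim s fun _ => Set.univ) := by
    ext g
    simp [Set.mem_pi]
  rw [this, Measure.pi_pi, Fintype.prod_sum_type]
  simp

theorem measurePreserving_comp_inr :
    MeasurePreserving (fun g : α ⊕ β → ℝ => g ∘ Sum.inr) (stdGauss (α ⊕ β)) (stdGauss β) := by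
  have hm : Measurable (fun g : α ⊕ β → ℝ => g ∘ Sum.inr) :=
    measurable_pi_lambda _ fun a => measurable_pi_apply _
  refine ⟨hm, (Measure.pi_eq fun s hs => ?_).symm⟩
  rw [Measure.map_apply hm (MeasurableSet.univ_pi hs)]
  have : (fun g : α ⊕ β → ℝ => g ∘ Sum.inr) ⁻¹' (Set.univ.pi s)
      = Set.univ.pi (Sum.elim (fun _ => Set.univ) s) := by
    ext g
    simp [Set.mem_pi]
  rw [this, Measure.pi_pi, Fintype.prod_sum_type]
  simp

theorem exists_abs_le_of_finset {ι : Type*} [Fintype ι] (S : Finset κ) (A : κ → ι → ℝ) :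
    ∃ M : ℝ, ∀ σ ∈ S, ∀ a, |A σ a| ≤ M := by
  refine ⟨∑ σ ∈ S, ∑ a, |A σ a|, fun σ hσ a => ?_⟩
  refine (Finset.single_le_sum (f := fun a => |A σ a|) (fun _ _ => abs_nonneg _)
    (Finset.mem_univ a)).trans ?_
  exact Finset.single_le_sum (f := fun σ => ∑ a, |A σ a|)
    (fun _ _ => Finset.sum_nonneg fun _ _ => abs_nonneg _) hσ

/-- Gaussian comparison for log-partition functions (Kahane, Guerra): enlarging the covariance of a
compensated Gaussian field decreases the expected log-partition function. -/
theorem integral_lse_gfield_le {S : Finset κ} {w : κ → ℝ} (hw : ∀ σ ∈ S, 0 ≤ w σ)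
    (hpos : 0 < ∑ σ ∈ S, w σ) (A : κ → α → ℝ) (B : κ → β → ℝ) {K : ℝ}
    (hK : ∀ σ ∈ S, ∀ τ ∈ S, ∑ b, B σ b * B τ b ≤ ∑ a, A σ a * A τ a + K) :
    ∫ g, lse S w (gfield A (fun _ => 1) g) ∂(stdGauss α)
      ≤ ∫ g, lse S w (gfield B (fun _ => 1) g) ∂(stdGauss β) + K / 2 := by
  set D : κ → α ⊕ β → ℝ := fun σ => Sum.elim (A σ) (B σ) with hD
  obtain ⟨M, hM⟩ := exists_abs_le_of_finset S D
  set c : ℝ → α ⊕ β → ℝ := fun θ => Sum.elim (fun _ => Real.sin θ) (fun _ => Real.cos θ) with hcdef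
  set c' : ℝ → α ⊕ β → ℝ := fun θ => Sum.elim (fun _ => Real.cos θ) (fun _ => -Real.sin θ)
    with hcdef'
  have hc : ∀ s a, |c s a| ≤ 1 := by
    rintro s (a | a)
    · exact Real.abs_sin_le_one s
    · exact Real.abs_cos_le_one s
  have hc' : ∀ s a, |c' s a| ≤ 1 := by
    rintro s (a | a)
    · exact Real.abs_cos_le_one s
    · simpa [hcdef'] using Real.abs_sin_le_one s
  have hd : ∀ s a, HasDerivAt (fun s => c s a) (c' s a) s := by
    rintro s (a | a)
    · exact Real.hasDerivAt_sin s
    · exact Real.hasDerivAt_cos s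
  set φ : ℝ → ℝ := fun θ => ∫ g, lse S w (gfield D (c θ) g) ∂(stdGauss (α ⊕ β)) with hφ
  have hφ' := fun θ => hasDerivAt_integral_lse_gfield hw hpos hM hc hc' hd θ
  have hle : ∀ θ, 0 ≤ Real.sin θ → 0 ≤ Real.cos θ →
      ∫ g, -∑ a, c θ a * c' θ a * gibbs S w (gfield D (c θ) g) (fun σ => D σ a) ^ 2
        ∂(stdGauss (α ⊕ β)) ≤ Real.sin θ * Real.cos θ * K := by
    intro θ hs hco
    have hpt : ∀ g, -∑ a, c θ a * c' θ a * gibbs S w (gfield D (c θ) g) (fun σ => D σ a) ^ 2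
        ≤ Real.sin θ * Real.cos θ * K := by
      intro g
      set E := gfield D (c θ) g
      have hcov : ∑ b, gibbs S w E (fun σ => B σ b) ^ 2
          ≤ ∑ a, gibbs S w E (fun σ => A σ a) ^ 2 + K := by
        rw [Finset.sum_congr rfl fun b _ => pow_two _, Finset.sum_congr rfl fun a _ => pow_two _]
        simp only [gibbs_mul_gibbs]
        rw [← gibbs_sum, ← gibbs_sum]
        have : (gibbs S w E fun σ => ∑ a, gibbs S w E fun τ => A σ a * A τ a) + K
            = gibbs S w E fun σ => gibbs S w E fun τ => ∑ a, A σ a * A τ a - -K := by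
          simp only [gibbs_sub, gibbs_const hw hpos, gibbs_sum]
          ring
        rw [this]
        refine gibbs_mono hw hpos fun σ hσ => ?_
        rw [← gibbs_sum]
        refine gibbs_mono hw hpos fun τ hτ => ?_
        linarith [hK σ hσ τ hτ]
      rw [Fintype.sum_sum_type]
      simp only [hcdef, hcdef', hD, Sum.elim_inl, Sum.elim_inr]
      simp only [← Finset.mul_sum]
      have := mul_le_mul_of_nonneg_left hcov (mul_nonneg hs hco)
      linarith
    by_cases hfi : Integrable (fun g => -∑ a, c θ a * c' θ a *
        gibbs S w (gfield D (c θ) g) (fun σ => D σ a) ^ 2) (stdGauss (α ⊕ β))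
    · calc _ ≤ ∫ _, Real.sin θ * Real.cos θ * K ∂(stdGauss (α ⊕ β)) :=
            integral_mono hfi (integrable_const _) hpt
        _ = _ := by simp
    · exfalso
      apply hfi
      have hm : ∀ a, Measurable fun g => gibbs S w (gfield D (c θ) g) (fun σ => D σ a) :=
        fun a => measurable_gibbs (fun σ => measurable_gfield D _ σ) (fun σ => measurable_const)
      refine (integrable_finsetSum _ fun a _ => Integrable.const_mul ?_ _).neg
      refine Integrable.of_bound ((hm a).pow_const 2).aestronglyMeasurable (M ^ 2)
        (Eventually.of_forall fun g => ?_)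
      rw [norm_pow]
      exact pow_le_pow_left₀ (abs_nonneg _) (abs_gibbs_le hw hpos fun σ hσ => hM σ hσ a) 2
  set ψ : ℝ → ℝ := fun θ => φ θ - K / 2 * Real.sin θ ^ 2 with hψ
  have hψ' := fun θ => (hφ' θ).sub (((Real.hasDerivAt_sin θ).pow 2).const_mul (K / 2))
  have hanti : AntitoneOn ψ (Set.Icc 0 (Real.pi / 2)) := by
    refine antitoneOn_of_deriv_nonpos (convex_Icc _ _)
      (fun θ _ => (hψ' θ).continuousAt.continuousWithinAt)
      (fun θ _ => (hψ' θ).differentiableAt.differentiableWithinAt) fun θ hθ => ?_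
    rw [interior_Icc] at hθ
    have hs := Real.sin_nonneg_of_nonneg_of_le_pi hθ.1.le (by linarith [hθ.2, Real.pi_pos])
    have hco := Real.cos_nonneg_of_mem_Icc (x := θ) ⟨by linarith [hθ.1, Real.pi_pos], hθ.2.le⟩
    have hd := (hψ' θ).deriv
    have h := hle θ hs hco
    have hd' : deriv ψ θ = _ := hd
    rw [hd']
    simp only [Nat.cast_ofNat, Nat.add_one_sub_one, pow_one]
    linarith
  have h0 : ψ 0 = ∫ g, lse S w (gfield B (fun _ => 1) g) ∂(stdGauss β) := by
    have e : ∀ g : α ⊕ β → ℝ, gfield D (c 0) g = gfield B (fun _ => 1) (g ∘ Sum.inr) := by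
      intro g; funext σ
      simp [gfield, hD, hcdef, Fintype.sum_sum_type]
    have hmp := measurePreserving_comp_inr (α := α) (β := β)
    simp only [hψ, hφ, e, Real.sin_zero]
    rw [← hmp.map_eq, integral_map hmp.aemeasurable
      (measurable_lse fun σ => measurable_gfield B _ σ).aestronglyMeasurable]
    simp
  have h1 : ψ (Real.pi / 2) = ∫ g, lse S w (gfield A (fun _ => 1) g) ∂(stdGauss α) - K / 2 := by
    have e : ∀ g : α ⊕ β → ℝ,
        gfield D (c (Real.pi / 2)) g = gfield A (fun _ => 1) (g ∘ Sum.inl) := by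
      intro g; funext σ
      simp [gfield, hD, hcdef, Fintype.sum_sum_type]
    have hmp := measurePreserving_comp_inl (α := α) (β := β)
    simp only [hψ, hφ, e, Real.sin_pi_div_two]
    rw [← hmp.map_eq, integral_map hmp.aemeasurable
      (measurable_lse fun σ => measurable_gfield A _ σ).aestronglyMeasurable]
    simp
  have := hanti (Set.left_mem_Icc.2 (by positivity)) (Set.right_mem_Icc.2 (by positivity))
    (by positivity : (0 : ℝ) ≤ Real.pi / 2)
  rw [h0, h1] at this
  linarith

end Comparison

section Channel

theorem gaussianReal_eq_withDensity (m : ℝ) {v : NNReal} (hv : v ≠ 0) :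
    gaussianReal m v = (gaussianReal 0 v).withDensity
      fun y => ENNReal.ofReal (Real.exp (m * y / v - m ^ 2 / (2 * v))) := by
  have hm : Measurable fun y : ℝ => ENNReal.ofReal (Real.exp (m * y / v - m ^ 2 / (2 * v))) := by
    fun_prop
  rw [gaussianReal_of_var_ne_zero m hv, gaussianReal_of_var_ne_zero 0 hv,
    ← withDensity_mul _ (measurable_gaussianPDF 0 v) hm]
  congr 1
  funext y
  have hv' : (v : ℝ) ≠ 0 := by exact_mod_cast hv
  rw [Pi.mul_apply, gaussianPDF, gaussianPDF, ← ENNReal.ofReal_mul (gaussianPDFReal_nonneg _ _ _),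
    gaussianPDFReal, gaussianPDFReal, mul_assoc _ (Real.exp _) (Real.exp _), ← Real.exp_add]
  congr 3
  field_simp
  ring

theorem pi_gaussianReal_eq_withDensity {ι : Type*} [Fintype ι] (m : ι → ℝ) {v : NNReal}
    (hv : v ≠ 0) :
    (Measure.pi fun a => gaussianReal (m a) v)
      = (Measure.pi fun _ : ι => gaussianReal 0 v).withDensity
        fun y => ENNReal.ofReal (Real.exp (∑ a, (m a * y a / v - m a ^ 2 / (2 * v)))) := by
  refine Measure.pi_eq fun s hs => ?_
  set f : ι → ℝ → ENNReal := fun a y =>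
    ENNReal.ofReal (Real.exp (m a * y / v - m a ^ 2 / (2 * v))) with hf
  have hfm : ∀ a, Measurable (f a) := fun a => by simp only [hf]; fun_prop
  rw [withDensity_apply _ (MeasurableSet.univ_pi hs), ← lintegral_indicator
    (MeasurableSet.univ_pi hs)]
  have e : ∀ y : ι → ℝ, (Set.univ.pi s).indicator (fun y : ι → ℝ =>
      ENNReal.ofReal (Real.exp (∑ a, (m a * y a / v - m a ^ 2 / (2 * v))))) y
      = ∏ a, (s a).indicator (f a) (y a) := by
    intro y
    by_cases hy : y ∈ Set.univ.pi s
    · rw [Set.indicator_of_mem hy, Real.exp_sum,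
        ENNReal.ofReal_prod_of_nonneg fun _ _ => (Real.exp_pos _).le]
      refine Finset.prod_congr rfl fun a _ => ?_
      rw [Set.indicator_of_mem (hy a (Set.mem_univ a))]
    · rw [Set.indicator_of_notMem hy]
      simp only [Set.mem_pi, Set.mem_univ, true_implies, not_forall] at hy
      obtain ⟨a, ha⟩ := hy
      exact (Finset.prod_eq_zero (Finset.mem_univ a) (Set.indicator_of_notMem ha _)).symm
  rw [lintegral_congr e]
  have hind : ∀ a, Measurable ((s a).indicator (f a)) := fun a => (hfm a).indicator (hs a)
  rw [lintegral_prod_eq_prod_lintegral_of_indepFun Finset.univ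
    (fun a (y : ι → ℝ) => (s a).indicator (f a) (y a))
    (iIndepFun_pi fun a => (hind a).aemeasurable)
    (fun a => (hind a).comp (measurable_pi_apply a))]
  refine Finset.prod_congr rfl fun a _ => ?_
  rw [(measurePreserving_eval (fun _ : ι => gaussianReal 0 v) a).lintegral_comp (hind a),
    lintegral_indicator (hs a), gaussianReal_eq_withDensity (m a) hv, withDensity_apply _ (hs a)]

theorem stdGauss_map_shift {ι : Type*} [Fintype ι] (m : ι → ℝ) {Δ : ℝ} (hΔ : 0 < Δ) :
    (stdGauss ι).map (fun ξ a => m a + Real.sqrt Δ * ξ a)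
      = (Measure.pi fun _ : ι => gaussianReal 0 Δ.toNNReal).withDensity
        fun y => ENNReal.ofReal (Real.exp (∑ a, (m a * y a / Δ - m a ^ 2 / (2 * Δ)))) := by
  have h := pi_gaussianReal_eq_withDensity m (v := Δ.toNNReal) (by simpa using hΔ)
  rw [Real.coe_toNNReal _ hΔ.le] at h
  rw [← h]
  have h1 : ∀ a, (gaussianReal 0 1).map (fun z => m a + Real.sqrt Δ * z)
      = gaussianReal (m a) Δ.toNNReal := by
    intro a
    rw [show (fun z => m a + Real.sqrt Δ * z) = (fun z => m a + z) ∘ (fun z => Real.sqrt Δ * z)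
      from rfl, ← Measure.map_map (by fun_prop) (by fun_prop), gaussianReal_map_const_mul,
      gaussianReal_map_const_add]
    congr 1
    · simp
    · ext
      simp [Real.sq_sqrt hΔ.le, hΔ.le]
  have h2 : (fun a => gaussianReal (m a) Δ.toNNReal)
      = fun a => (gaussianReal 0 1).map (fun z => m a + Real.sqrt Δ * z) := funext fun a => (h1 a).symm
  rw [h2]
  have : ∀ a, IsProbabilityMeasure ((gaussianReal 0 1).map (fun z => m a + Real.sqrt Δ * z)) :=
    fun a => by rw [h1]; infer_instance
  exact Measure.pi_map_pi (μ := fun _ : ι => gaussianReal 0 1)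
    (f := fun a z => m a + Real.sqrt Δ * z) fun a => by fun_prop

variable {X ι : Type*} [MeasurableSpace X] [Fintype ι]

/-- Log-likelihood ratio of the observation `y`, with mean `m`, relative to pure noise of
variance `Δ`. -/
def logLik (Δ : ℝ) (m y : ι → ℝ) : ℝ := ∑ a, (m a * y a / Δ - m a ^ 2 / (2 * Δ))

/-- Mutual information of an additive Gaussian channel with signal `m`. -/
theorem mutualInfoR_gaussian_channel (P : Measure X) [IsProbabilityMeasure P] {m : X → ι → ℝ}
    (hm : Measurable m) {Δ : ℝ} (hΔ : 0 < Δ) :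
    mutualInfoR ((P.prod (stdGauss ι)).map fun w => (w.1, fun a => m w.1 a + Real.sqrt Δ * w.2 a))
      = ∫ w, (logLik Δ (m w.1) (fun a => m w.1 a + Real.sqrt Δ * w.2 a)
          - Real.log (∫ x, Real.exp (logLik Δ (m x) (fun a => m w.1 a + Real.sqrt Δ * w.2 a)) ∂P))
        ∂(P.prod (stdGauss ι)) := by
  set T : X × (ι → ℝ) → X × (ι → ℝ) := fun w => (w.1, fun a => m w.1 a + Real.sqrt Δ * w.2 a)
    with hT
  have hma : ∀ a, Measurable fun x => m x a := fun a => (measurable_pi_apply a).comp hm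
  have hTm : Measurable T := by
    refine measurable_fst.prodMk (measurable_pi_lambda _ fun a => ?_)
    exact ((hma a).comp measurable_fst).add
      (((measurable_pi_apply a).comp measurable_snd).const_mul _)
  set Q : Measure (ι → ℝ) := Measure.pi fun _ : ι => gaussianReal 0 Δ.toNNReal with hQ
  set l : X × (ι → ℝ) → ℝ := fun w => logLik Δ (m w.1) w.2 with hl
  have hlm : Measurable l := by
    simp only [hl, logLik]
    refine Finset.measurable_fun_sum _ fun a _ => ?_
    have h1 : Measurable fun w : X × (ι → ℝ) => m w.1 a := (hma a).comp measurable_fst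
    have h2 : Measurable fun w : X × (ι → ℝ) => w.2 a :=
      (measurable_pi_apply a).comp measurable_snd
    exact ((h1.mul h2).div_const _).sub ((h1.pow_const 2).div_const _)
  set L : X × (ι → ℝ) → ENNReal := fun w => ENNReal.ofReal (Real.exp (l w)) with hL
  have hLm : Measurable L := hlm.exp.ennreal_ofReal
  set μ := (P.prod (stdGauss ι)).map T with hμ
  have : IsProbabilityMeasure μ := Measure.isProbabilityMeasure_map hTm.aemeasurable
  have hμd : μ = (P.prod Q).withDensity L := by
    ext s hs
    rw [hμ, Measure.map_apply hTm hs, Measure.prod_apply (hTm hs), withDensity_apply _ hs,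
      ← lintegral_indicator hs, lintegral_prod _ (hLm.indicator hs).aemeasurable]
    refine lintegral_congr fun x => ?_
    have hsx : MeasurableSet (Prod.mk x ⁻¹' s) := measurable_prodMk_left hs
    have hshift := stdGauss_map_shift (m x) hΔ
    have hmx : Measurable fun (ξ : ι → ℝ) a => m x a + Real.sqrt Δ * ξ a := by fun_prop
    have : (Prod.mk x ⁻¹' (T ⁻¹' s))
        = (fun (ξ : ι → ℝ) a => m x a + Real.sqrt Δ * ξ a) ⁻¹' (Prod.mk x ⁻¹' s) := rfl
    rw [this, ← Measure.map_apply hmx hsx, hshift, withDensity_apply _ hsx,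
      ← lintegral_indicator hsx]
    rfl
  set Z : (ι → ℝ) → ENNReal := fun y => ∫⁻ x, L (x, y) ∂P with hZ
  have hZm : Measurable Z := hLm.lintegral_prod_left'
  have hfst : μ.fst = P := by
    rw [Measure.fst, hμ, Measure.map_map measurable_fst hTm]
    exact Measure.fst_prod
  have hsnd : μ.snd = Q.withDensity Z := by
    ext s hs
    rw [Measure.snd_apply hs, hμd, withDensity_apply _ (measurable_snd hs),
      withDensity_apply _ hs, ← lintegral_indicator (measurable_snd hs),
      lintegral_prod_symm _ (hLm.indicator (measurable_snd hs)).aemeasurable,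
      ← lintegral_indicator hs]
    refine lintegral_congr fun y => ?_
    by_cases hy : y ∈ s
    · simp [Set.indicator, hy, hZ]
    · simp [Set.indicator, hy]
  have hZpos : ∀ y, Z y ≠ 0 := by
    intro y h
    have h' : ∫⁻ x, L (x, y) ∂P = 0 := h
    rw [lintegral_eq_zero_iff (f := fun x => L (x, y)) (hLm.comp measurable_prodMk_right)] at h'
    have : ∀ᵐ _ ∂P, False := h'.mono fun x hx => by
      simp only [hL, Pi.zero_apply, ENNReal.ofReal_eq_zero] at hx
      exact absurd hx (not_le.2 (Real.exp_pos _))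
    exact IsProbabilityMeasure.ne_zero P (by simpa using this)
  have : IsProbabilityMeasure μ.snd := Measure.isProbabilityMeasure_map measurable_snd.aemeasurable
  have hZfin : ∀ᵐ y ∂Q, Z y < ⊤ := by
    refine ae_lt_top hZm ?_
    have : ∫⁻ y, Z y ∂Q = 1 := by
      rw [← setLIntegral_univ, ← withDensity_apply _ MeasurableSet.univ, ← hsnd, measure_univ]
    rw [this]; exact ENNReal.one_ne_top
  have hν : μ.fst.prod μ.snd = (P.prod Q).withDensity fun w => Z w.2 := by
    rw [hfst, hsnd, prod_withDensity_right hZm]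
  obtain ⟨ν, hνdef⟩ : ∃ ν, ν = μ.fst.prod μ.snd := ⟨_, rfl⟩
  rw [← hνdef] at hν
  have : IsProbabilityMeasure μ.fst := by rw [hfst]; infer_instance
  have : IsProbabilityMeasure ν := by rw [hνdef]; infer_instance
  have hZfin' : ∀ᵐ w ∂(P.prod Q), Z w.2 < ⊤ := Measure.quasiMeasurePreserving_snd.ae hZfin
  have hZm' : Measurable fun w : X × (ι → ℝ) => Z w.2 := hZm.comp measurable_snd
  have hR : Measurable fun w : X × (ι → ℝ) => L w / Z w.2 := hLm.div hZm'
  have hμν : μ = ν.withDensity fun w => L w / Z w.2 := by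
    rw [hν, ← withDensity_mul _ hZm' hR, hμd]
    refine withDensity_congr_ae ?_
    filter_upwards [hZfin'] with w hw
    exact (ENNReal.mul_div_cancel (hZpos _) hw.ne).symm
  have hac : μ ≪ ν := by
    rw [hμν]; exact withDensity_absolutelyContinuous _ _
  have hac' : ν ≪ P.prod Q := by
    rw [hν]; exact withDensity_absolutelyContinuous _ _
  have hrn : μ.rnDeriv ν =ᵐ[μ] fun w => L w / Z w.2 := by
    have h := Measure.rnDeriv_withDensity ν hR
    rw [← hμν] at h
    exact hac.ae_le h
  have hllr : llr μ ν =ᵐ[μ] fun w => l w - Real.log (∫ x, Real.exp (l (x, w.2)) ∂P) := by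
    filter_upwards [hrn, hac.ae_le (hac'.ae_le hZfin')] with w hw hw'
    have hZr : ∫ x, Real.exp (l (x, w.2)) ∂P = (Z w.2).toReal :=
      integral_eq_lintegral_of_nonneg_ae (Eventually.of_forall fun x => (Real.exp_pos _).le)
        (hlm.comp measurable_prodMk_right).exp.aestronglyMeasurable
    rw [llr, hw, ENNReal.toReal_div, hL, ENNReal.toReal_ofReal (Real.exp_pos _).le,
      Real.log_div (Real.exp_pos _).ne' (ENNReal.toReal_ne_zero.2 ⟨hZpos _, hw'.ne⟩),
      Real.log_exp, hZr]
  rw [mutualInfoR, klDivR, ← hνdef, integral_congr_ae hllr, hμ, integral_map hTm.aemeasurable]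
  refine Measurable.aestronglyMeasurable (hlm.sub (Measurable.log ?_))
  refine StronglyMeasurable.measurable ?_
  refine StronglyMeasurable.integral_prod_right (f := fun (w : X × (ι → ℝ)) (x : X) =>
    Real.exp (l (x, w.2))) ?_
  exact (hlm.comp (measurable_snd.prodMk (measurable_snd.comp measurable_fst))).exp.stronglyMeasurable

end Channel

section FiniteSupport
variable {X : Type*}

theorem lse_mul_exp (S : Finset X) (w e E : X → ℝ) :
    lse S (fun σ => w σ * Real.exp (e σ)) E = lse S w (fun σ => e σ + E σ) := by
  simp only [lse, mul_assoc, ← Real.exp_add]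

variable [MeasurableSpace X] {P : Measure X} {S : Finset X}

theorem ae_mem_of_finset_support (hS : P (↑S : Set X)ᶜ = 0) : ∀ᵐ x ∂P, x ∈ S := by
  rw [ae_iff]
  exact hS

variable [MeasurableSingletonClass X]

theorem integrable_of_finset_support [IsFiniteMeasure P] (hS : P (↑S : Set X)ᶜ = 0) (f : X → ℝ) :
    Integrable f P := by
  have h : IntegrableOn f S P := IntegrableOn.finset
  rwa [IntegrableOn, Measure.restrict_eq_self_of_ae_mem (ae_mem_of_finset_support hS)] at h

theorem integral_of_finset_support [IsFiniteMeasure P] (hS : P (↑S : Set X)ᶜ = 0) (f : X → ℝ) :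
    ∫ x, f x ∂P = ∑ σ ∈ S, P.real {σ} * f σ := by
  have h := setIntegral_finset S (μ := P) (f := f) IntegrableOn.finset
  rwa [Measure.restrict_eq_self_of_ae_mem (ae_mem_of_finset_support hS)] at h

theorem sum_real_singleton_of_finset_support [IsProbabilityMeasure P]
    (hS : P (↑S : Set X)ᶜ = 0) : ∑ σ ∈ S, P.real {σ} = 1 := by
  simpa using (integral_of_finset_support hS fun _ => 1).symm

variable {ι : Type*} [Fintype ι]

theorem logLik_add_noise {Δ : ℝ} (hΔ : 0 < Δ) (m m' ξ : ι → ℝ) :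
    logLik Δ m (fun a => m' a + Real.sqrt Δ * ξ a)
      = ∑ a, m a * m' a / Δ + ∑ a, (m a / Real.sqrt Δ * ξ a - (m a / Real.sqrt Δ) ^ 2 / 2) := by
  rw [logLik, ← Finset.sum_add_distrib]
  refine Finset.sum_congr rfl fun a _ => ?_
  obtain ⟨r, hr, rfl⟩ : ∃ r, 0 < r ∧ Δ = r ^ 2 :=
    ⟨_, Real.sqrt_pos.2 hΔ, (Real.sq_sqrt hΔ.le).symm⟩
  rw [Real.sqrt_sq hr.le]
  field_simp
  ring

/-- Mutual information of an additive Gaussian channel whose input has finite support. -/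
theorem mutualInfoR_gaussian_channel_of_finset_support [IsProbabilityMeasure P]
    (hS : P (↑S : Set X)ᶜ = 0) {m : X → ι → ℝ} (hm : Measurable m) {Δ : ℝ} (hΔ : 0 < Δ) :
    mutualInfoR ((P.prod (stdGauss ι)).map fun w => (w.1, fun a => m w.1 a + Real.sqrt Δ * w.2 a))
      = ∫ x, (∑ a, m x a ^ 2 / (2 * Δ)
          - ∫ ξ, lse S (fun σ => P.real {σ} * Real.exp (∑ a, m σ a * m x a / Δ))
              (gfield (fun σ a => m σ a / Real.sqrt Δ) (fun _ => 1) ξ) ∂(stdGauss ι)) ∂P := by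
  set A : X → ι → ℝ := fun σ a => m σ a / Real.sqrt Δ with hA
  have hma : ∀ a, Measurable fun x => m x a := fun a => (measurable_pi_apply a).comp hm
  set F : X × (ι → ℝ) → ℝ := fun w => (∑ a, m w.1 a ^ 2 / (2 * Δ) + ∑ a, A w.1 a * w.2 a)
      - lse S (fun σ => P.real {σ})
        (fun σ => ∑ a, m σ a * m w.1 a / Δ + gfield A (fun _ => 1) w.2 σ) with hF
  have hFm : Measurable F := by
    have h1 : ∀ a, Measurable fun w : X × (ι → ℝ) => m w.1 a := fun a =>
      (hma a).comp measurable_fst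
    have h2 : ∀ a, Measurable fun w : X × (ι → ℝ) => w.2 a := fun a =>
      (measurable_pi_apply a).comp measurable_snd
    refine ((Finset.measurable_fun_sum _ fun a _ => ((h1 a).pow_const 2).div_const _).add
      (Finset.measurable_fun_sum _ fun a _ => ((h1 a).div_const _).mul (h2 a))).sub
      (measurable_lse fun σ => ?_)
    exact (Finset.measurable_fun_sum _ fun a _ => ((h1 a).const_mul _).div_const _).add
      ((measurable_gfield A _ σ).comp measurable_snd)
  have hsum := sum_real_singleton_of_finset_support hS
  have hw : ∀ x, ∀ σ ∈ S, 0 ≤ P.real {σ} * Real.exp (∑ a, m σ a * m x a / Δ) := fun x σ _ =>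
    mul_nonneg measureReal_nonneg (Real.exp_pos _).le
  have hpos : ∀ x, 0 < ∑ σ ∈ S, P.real {σ} * Real.exp (∑ a, m σ a * m x a / Δ) := fun x =>
    sum_mul_exp_pos (fun σ _ => measureReal_nonneg) (by rw [hsum]; exact one_pos) _
  obtain ⟨M, hM⟩ := exists_abs_le_of_finset S A
  have hfi : ∀ x, Integrable (fun ξ => lse S
      (fun σ => P.real {σ} * Real.exp (∑ a, m σ a * m x a / Δ)) (gfield A (fun _ => 1) ξ))
      (stdGauss ι) := fun x => integrable_lse_gfield (hw x) (hpos x) hM fun _ => by simp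
  have hlin : ∀ x a, Integrable (fun ξ : ι → ℝ => A x a * ξ a) (stdGauss ι) := fun x a =>
    (integrable_eval_stdGauss a).const_mul _
  have hlin' : ∀ x, Integrable (fun ξ : ι → ℝ => ∑ a, m x a ^ 2 / (2 * Δ) + ∑ a, A x a * ξ a)
      (stdGauss ι) := fun x =>
    (integrable_const _).add (integrable_finsetSum _ fun a _ => hlin x a)
  have hFx : ∀ x, (fun ξ => F (x, ξ)) = fun ξ => (∑ a, m x a ^ 2 / (2 * Δ) + ∑ a, A x a * ξ a)
      - lse S (fun σ => P.real {σ} * Real.exp (∑ a, m σ a * m x a / Δ))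
        (gfield A (fun _ => 1) ξ) := fun x => by
    funext ξ
    rw [lse_mul_exp]
  have hFint : Integrable F (P.prod (stdGauss ι)) := by
    rw [integrable_prod_iff hFm.aestronglyMeasurable]
    refine ⟨Eventually.of_forall fun x => ?_, integrable_of_finset_support hS _⟩
    rw [hFx]
    exact (hlin' x).sub (hfi x)
  rw [mutualInfoR_gaussian_channel P hm hΔ]
  have hpt : ∀ w : X × (ι → ℝ), logLik Δ (m w.1) (fun a => m w.1 a + Real.sqrt Δ * w.2 a)
      - Real.log (∫ x, Real.exp (logLik Δ (m x) (fun a => m w.1 a + Real.sqrt Δ * w.2 a)) ∂P)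
      = F w := by
    intro w
    simp only [hF]
    congr 1
    · rw [logLik_add_noise hΔ, ← Finset.sum_add_distrib, ← Finset.sum_add_distrib]
      refine Finset.sum_congr rfl fun a _ => ?_
      rw [div_pow, Real.sq_sqrt hΔ.le]
      simp only [hA]
      field_simp
      ring
    · rw [integral_of_finset_support hS, lse]
      refine congrArg Real.log (Finset.sum_congr rfl fun σ _ => ?_)
      rw [logLik_add_noise hΔ]
      simp only [gfield, hA, one_mul, one_pow]
  rw [integral_congr_ae (Eventually.of_forall hpt), integral_prod F hFint]
  refine integral_congr_ae (Eventually.of_forall fun x => ?_)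
  have h0 : ∫ ξ : ι → ℝ, ∑ a, A x a * ξ a ∂(stdGauss ι) = 0 := by
    rw [integral_finsetSum _ fun a _ => hlin x a]
    refine Finset.sum_eq_zero fun a _ => ?_
    rw [integral_const_mul, integral_comp_eval (μ := fun _ : ι => gaussianReal 0 1)
      (f := fun z : ℝ => z) (by fun_prop)]
    simp
  simp only [hFx]
  rw [integral_sub (hlin' x) (hfi x), integral_add (integrable_const _)
    (integrable_finsetSum _ fun a _ => hlin x a), h0]
  simp

end FiniteSupport

section SpikedWigner
variable {n : ℕ}

/-- The mean `x_i x_j / √n` of the observations. -/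
def spikeMean (n : ℕ) (x : Fin n → ℝ) (a : SymIdx n) : ℝ := x a.1.1 * x a.1.2 / Real.sqrt n

theorem measurable_spikeMean (n : ℕ) : Measurable (spikeMean n) := by
  unfold spikeMean
  fun_prop

theorem sum_symIdx_mul (u : Fin n → ℝ) :
    ∑ a : SymIdx n, u a.1.1 * u a.1.2 = ((∑ i, u i) ^ 2 + ∑ i, u i ^ 2) / 2 := by
  have h1 : ∑ a : SymIdx n, u a.1.1 * u a.1.2
      = ∑ i, ∑ j, if i ≤ j then u i * u j else 0 := by
    rw [← Fintype.sum_prod_type' (f := fun i j => if i ≤ j then u i * u j else 0),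
      ← Finset.sum_filter]
    exact (Finset.sum_subtype _ (by simp) fun q : Fin n × Fin n => u q.1 * u q.2).symm
  have h2 : ∑ a : SymIdx n, u a.1.1 * u a.1.2
      = ∑ i, ∑ j, if j ≤ i then u i * u j else 0 := by
    rw [h1, Finset.sum_comm]
    simp only [mul_comm]
  have h3 : ∑ i, ∑ j, ((if i ≤ j then u i * u j else 0) + (if j ≤ i then u i * u j else 0))
      = ∑ i, ∑ j, (u i * u j + if i = j then u i * u j else 0) := by
    refine Finset.sum_congr rfl fun i _ => Finset.sum_congr rfl fun j _ => ?_
    rcases lt_trichotomy i j with h | h | h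
    · simp [h.le, h.not_ge, h.ne]
    · simp [h]
    · simp [h.le, h.not_ge, h.ne']
  simp only [Finset.sum_add_distrib] at h3
  rw [← h1, ← h2, ← Finset.sum_mul_sum] at h3
  simp only [Finset.sum_ite_eq, Finset.mem_univ, if_true] at h3
  simp only [pow_two]
  linarith

theorem sum_spikeMean_mul (x y : Fin n → ℝ) :
    ∑ a, spikeMean n x a * spikeMean n y a
      = ((∑ i, x i * y i) ^ 2 + ∑ i, (x i * y i) ^ 2) / (2 * n) := by
  have h := sum_symIdx_mul fun i => x i * y i
  have h' : ∀ a : SymIdx n, spikeMean n x a * spikeMean n y a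
      = (x a.1.1 * y a.1.1) * (x a.1.2 * y a.1.2) / n := fun a => by
    rw [spikeMean, spikeMean, div_mul_div_comm, Real.mul_self_sqrt (Nat.cast_nonneg n)]
    ring
  rw [Finset.sum_congr rfl fun a _ => h' a, ← Finset.sum_div, h, div_div]

variable {p : Measure ℝ}

/-- The weights induced by conditioning on the signal `x`. -/
def condWeight (p : Measure ℝ) (Δ : ℝ) (x σ : Fin n → ℝ) : ℝ :=
  (Measure.pi fun _ : Fin n => p).real {σ}
    * Real.exp (∑ a, spikeMean n σ a * spikeMean n x a / Δ)

theorem condWeight_nonneg (Δ : ℝ) (x σ : Fin n → ℝ) : 0 ≤ condWeight p Δ x σ :=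
  mul_nonneg measureReal_nonneg (Real.exp_pos _).le

variable [IsProbabilityMeasure p] {s : Finset ℝ} {M : ℝ}

theorem pi_finset_support (hs : p (↑s : Set ℝ)ᶜ = 0) :
    (Measure.pi fun _ : Fin n => p) (↑(Fintype.piFinset fun _ : Fin n => s) : Set (Fin n → ℝ))ᶜ
      = 0 := by
  have h : ∀ᵐ x ∂(Measure.pi fun _ : Fin n => p), ∀ i, x i ∈ s := ae_all_iff.2 fun i =>
    (measurePreserving_eval (fun _ : Fin n => p) i).quasiMeasurePreserving.ae
      (ae_mem_of_finset_support hs)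
  rw [ae_iff] at h
  convert h using 2
  ext x
  simp

theorem Jf_eq_lse (hs : p (↑s : Set ℝ)ᶜ = 0) (A B : ℝ) :
    Jf p A B = lse s (fun x => p.real {x}) (fun x => B * x - A * x ^ 2 / 2) := by
  rw [Jf, integral_of_finset_support hs, lse]

theorem abs_Jf_le (hs : p (↑s : Set ℝ)ᶜ = 0) (hM : ∀ x ∈ s, |x| ≤ M) (A B : ℝ) :
    |Jf p A B| ≤ M * |B| + |A| * M ^ 2 / 2 := by
  have hsum := sum_real_singleton_of_finset_support hs
  rw [Jf_eq_lse hs]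
  refine (abs_lse_le (B := M * |B| + |A| * M ^ 2 / 2) (fun _ _ => measureReal_nonneg)
    (by rw [hsum]; exact one_pos) fun x hx => ?_).trans (by rw [hsum]; simp)
  refine (abs_sub _ _).trans (add_le_add ?_ ?_)
  · rw [abs_mul, mul_comm]
    exact mul_le_mul_of_nonneg_right (hM x hx) (abs_nonneg _)
  · rw [abs_div, abs_mul, abs_two, abs_pow]
    have := pow_le_pow_left₀ (abs_nonneg _) (hM x hx) 2
    gcongr

theorem measurable_Jf (hs : p (↑s : Set ℝ)ᶜ = 0) (A : ℝ) : Measurable (Jf p A) := by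
  rw [show Jf p A = fun B => lse s (fun x => p.real {x}) (fun x => B * x - A * x ^ 2 / 2) from
    funext (Jf_eq_lse hs A)]
  exact measurable_lse fun x => by fun_prop

theorem exp_Jf (hs : p (↑s : Set ℝ)ᶜ = 0) (A B : ℝ) :
    Real.exp (Jf p A B) = ∫ x, Real.exp (B * x - A * x ^ 2 / 2) ∂p := by
  refine Real.exp_log ?_
  rw [integral_of_finset_support hs]
  exact sum_mul_exp_pos (fun _ _ => measureReal_nonneg)
    (by rw [sum_real_singleton_of_finset_support hs]; exact one_pos) _

theorem sum_piFinset_exp (hs : p (↑s : Set ℝ)ᶜ = 0) (A : ℝ) (b : Fin n → ℝ) :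
    ∑ σ ∈ Fintype.piFinset fun _ : Fin n => s, (Measure.pi fun _ : Fin n => p).real {σ}
        * Real.exp (∑ i, (b i * σ i - A * σ i ^ 2 / 2))
      = Real.exp (∑ i, Jf p A (b i)) := by
  rw [← integral_of_finset_support (pi_finset_support hs)
    fun σ : Fin n → ℝ => Real.exp (∑ i, (b i * σ i - A * σ i ^ 2 / 2))]
  simp only [Real.exp_sum, exp_Jf hs]
  exact integral_fintype_prod_eq_prod (μ := fun _ : Fin n => p)
    fun i x => Real.exp (b i * x - A * x ^ 2 / 2)

theorem sum_condWeight_pos (hs : p (↑s : Set ℝ)ᶜ = 0) (Δ : ℝ) (x : Fin n → ℝ) :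
    0 < ∑ σ ∈ Fintype.piFinset fun _ : Fin n => s, condWeight p Δ x σ :=
  sum_mul_exp_pos (fun _ _ => measureReal_nonneg)
    (by rw [sum_real_singleton_of_finset_support (pi_finset_support hs)]; exact one_pos) _

/-- The normalized observation field `x_i x_j / √(n Δ)`. -/
def obsField (Δ : ℝ) (σ : Fin n → ℝ) (a : SymIdx n) : ℝ := spikeMean n σ a / Real.sqrt Δ

theorem MI_eq (hs : p (↑s : Set ℝ)ᶜ = 0) {Δ : ℝ} (hΔ : 0 < Δ) (n : ℕ) :
    MI p Δ n = ∫ x, (∑ a, spikeMean n x a ^ 2 / (2 * Δ)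
      - ∫ ξ, lse (Fintype.piFinset fun _ : Fin n => s) (condWeight p Δ x)
          (gfield (obsField Δ) (fun _ => 1) ξ) ∂(stdGauss (SymIdx n)))
        ∂(Measure.pi fun _ : Fin n => p) :=
  mutualInfoR_gaussian_channel_of_finset_support (pi_finset_support hs) (measurable_spikeMean n) hΔ

theorem sum_obsField_mul {Δ : ℝ} (hΔ : 0 < Δ) (x y : Fin n → ℝ) :
    ∑ a, obsField Δ x a * obsField Δ y a
      = ((∑ i, x i * y i) ^ 2 + ∑ i, (x i * y i) ^ 2) / (2 * n * Δ) := by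
  simp only [obsField, div_mul_div_comm, Real.mul_self_sqrt hΔ.le]
  rw [← Finset.sum_div, sum_spikeMean_mul, div_div]

/-- Gaussian comparison of the quadratic observations with `n` scalar channels. -/
theorem integral_lse_obsField_le (hn : 0 < n) {Δ : ℝ} (hΔ : 0 < Δ) {q : ℝ} (hq : 0 ≤ q)
    {S : Finset (Fin n → ℝ)} {w : (Fin n → ℝ) → ℝ} (hw : ∀ σ ∈ S, 0 ≤ w σ)
    (hpos : 0 < ∑ σ ∈ S, w σ) :
    ∫ ξ, lse S w (gfield (obsField Δ) (fun _ => 1) ξ) ∂(stdGauss (SymIdx n))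
      ≤ ∫ z, lse S w (gfield (fun σ i => Real.sqrt (q / Δ) * σ i) (fun _ => 1) z)
          ∂(stdGauss (Fin n)) + n * q ^ 2 / (2 * Δ) / 2 := by
  refine integral_lse_gfield_le hw hpos _ _ fun σ _ τ _ => ?_
  rw [sum_obsField_mul hΔ]
  have h : ∑ i, Real.sqrt (q / Δ) * σ i * (Real.sqrt (q / Δ) * τ i)
      = q / Δ * ∑ i, σ i * τ i := by
    rw [Finset.mul_sum]
    refine Finset.sum_congr rfl fun i _ => ?_
    rw [mul_mul_mul_comm, Real.mul_self_sqrt (div_nonneg hq hΔ.le)]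
  rw [h]
  set R := ∑ i, σ i * τ i
  have hU : 0 ≤ ∑ i, (σ i * τ i) ^ 2 := Finset.sum_nonneg fun _ _ => sq_nonneg _
  set U := ∑ i, (σ i * τ i) ^ 2
  have hn' : (0 : ℝ) < n := by exact_mod_cast hn
  have : (R ^ 2 + U) / (2 * n * Δ) + n * q ^ 2 / (2 * Δ) - q / Δ * R
      = ((R - n * q) ^ 2 + U) / (2 * n * Δ) := by
    field_simp
    ring
  have h2 : 0 ≤ ((R - n * q) ^ 2 + U) / (2 * n * Δ) := by positivity
  linarith

/-- The free energy of the scalar channels conditioned on overlap `m`. -/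
def overlapEnergy (p : Measure ℝ) (Δ q m : ℝ) (x z : Fin n → ℝ) : ℝ :=
  ∑ i, (Jf p (q / Δ) (m * x i / Δ + Real.sqrt (q / Δ) * z i) - m ^ 2 / (2 * Δ))

theorem lse_condWeight_le (hn : 0 < n) (hs : p (↑s : Set ℝ)ᶜ = 0) (hM : ∀ x ∈ s, |x| ≤ M)
    {Δ : ℝ} (hΔ : 0 < Δ) {q : ℝ} (hq : 0 ≤ q) {G : Finset ℝ} {ε : ℝ}
    (hG : ∀ r : ℝ, |r| ≤ M ^ 2 → ∃ m ∈ G, |r - m| ≤ ε) {x : Fin n → ℝ} (hx : ∀ i, x i ∈ s)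
    (z : Fin n → ℝ) :
    lse (Fintype.piFinset fun _ : Fin n => s) (condWeight p Δ x)
        (gfield (fun σ i => Real.sqrt (q / Δ) * σ i) (fun _ => 1) z)
      ≤ M ^ 4 / (2 * Δ) + n * ε ^ 2 / (2 * Δ)
        + Real.log (∑ m ∈ G, Real.exp (overlapEnergy p Δ q m x z)) := by
  have hn' : (0 : ℝ) < n := by exact_mod_cast hn
  set C := M ^ 4 / (2 * Δ) + n * ε ^ 2 / (2 * Δ) with hC
  have key : ∀ σ : Fin n → ℝ, (∀ i, σ i ∈ s) → ∃ m ∈ G,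
      ∑ a, spikeMean n σ a * spikeMean n x a / Δ
        + gfield (fun (σ : Fin n → ℝ) i => Real.sqrt (q / Δ) * σ i) (fun _ => 1) z σ
      ≤ C + (∑ i, ((m * x i / Δ + Real.sqrt (q / Δ) * z i) * σ i - q / Δ * σ i ^ 2 / 2)
          - n * (m ^ 2 / (2 * Δ))) := by
    intro σ hσ
    have hprod : ∀ i, |σ i * x i| ≤ M ^ 2 := fun i => by
      rw [abs_mul, pow_two]
      exact mul_le_mul (hM _ (hσ i)) (hM _ (hx i)) (abs_nonneg _)
        ((abs_nonneg _).trans (hM _ (hσ i)))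
    set R := ∑ i, σ i * x i with hR
    have hRn : |R / n| ≤ M ^ 2 := by
      rw [abs_div, abs_of_pos hn', div_le_iff₀ hn']
      refine (Finset.abs_sum_le_sum_abs _ _).trans
        ((Finset.sum_le_sum fun i _ => hprod i).trans_eq ?_)
      simp [mul_comm]
    obtain ⟨m, hm, hrm⟩ := hG _ hRn
    refine ⟨m, hm, ?_⟩
    have hU : ∑ i, (σ i * x i) ^ 2 ≤ n * M ^ 4 := by
      refine (Finset.sum_le_sum (g := fun _ => M ^ 4) fun i _ => ?_).trans_eq (by simp)
      rw [← sq_abs, show M ^ 4 = (M ^ 2) ^ 2 by ring]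
      exact pow_le_pow_left₀ (abs_nonneg _) (hprod i) 2
    have h1 : gfield (fun (σ : Fin n → ℝ) i => Real.sqrt (q / Δ) * σ i) (fun _ => 1) z σ
        = ∑ i, ((m * x i / Δ + Real.sqrt (q / Δ) * z i) * σ i - q / Δ * σ i ^ 2 / 2)
          - m / Δ * R := by
      rw [gfield, hR, Finset.mul_sum, ← Finset.sum_sub_distrib]
      refine Finset.sum_congr rfl fun i _ => ?_
      rw [mul_pow, Real.sq_sqrt (div_nonneg hq hΔ.le)]
      ring
    rw [h1, ← Finset.sum_div, sum_spikeMean_mul, ← hR]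
    have h2 : (R / n - m) ^ 2 ≤ ε ^ 2 := by
      rw [← sq_abs]
      exact pow_le_pow_left₀ (abs_nonneg _) hrm 2
    have h3 : (R ^ 2 + ∑ i, (σ i * x i) ^ 2) / (2 * n) / Δ
        ≤ (R ^ 2 + n * M ^ 4) / (2 * n) / Δ := by gcongr
    have h4 : n * (R / n - m) ^ 2 / (2 * Δ) ≤ n * ε ^ 2 / (2 * Δ) := by gcongr
    have h5 : (R ^ 2 + n * M ^ 4) / (2 * n) / Δ = M ^ 4 / (2 * Δ) + n * (R / n - m) ^ 2 / (2 * Δ)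
        + m / Δ * R - n * (m ^ 2 / (2 * Δ)) := by
      field_simp
      ring
    rw [hC]
    linarith
  have hE : ∀ m, Real.exp (overlapEnergy p Δ q m x z)
      = ∑ σ ∈ Fintype.piFinset fun _ : Fin n => s, (Measure.pi fun _ : Fin n => p).real {σ}
        * Real.exp (∑ i, ((m * x i / Δ + Real.sqrt (q / Δ) * z i) * σ i - q / Δ * σ i ^ 2 / 2)
          - n * (m ^ 2 / (2 * Δ))) := by
    intro m
    have h1 := sum_piFinset_exp (n := n) hs (q / Δ)
      fun i => m * x i / Δ + Real.sqrt (q / Δ) * z i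
    have h2 : overlapEnergy p Δ q m x z
        = ∑ i, Jf p (q / Δ) (m * x i / Δ + Real.sqrt (q / Δ) * z i) - n * (m ^ 2 / (2 * Δ)) := by
      simp [overlapEnergy, Finset.sum_sub_distrib]
    rw [h2, Real.exp_sub, ← h1, Finset.sum_div]
    exact Finset.sum_congr rfl fun σ _ => by rw [Real.exp_sub, mul_div_assoc]
  have hle : ∑ σ ∈ Fintype.piFinset fun _ : Fin n => s, condWeight p Δ x σ
      * Real.exp (gfield (fun (σ : Fin n → ℝ) i => Real.sqrt (q / Δ) * σ i) (fun _ => 1) z σ)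
      ≤ Real.exp C * ∑ m ∈ G, Real.exp (overlapEnergy p Δ q m x z) := by
    simp only [hE]
    rw [Finset.sum_comm, Finset.mul_sum]
    refine Finset.sum_le_sum fun σ hσ => ?_
    obtain ⟨m, hm, h⟩ := key σ (Fintype.mem_piFinset.1 hσ)
    rw [condWeight, mul_assoc, ← Real.exp_add, ← Finset.mul_sum, mul_left_comm]
    refine mul_le_mul_of_nonneg_left ?_ measureReal_nonneg
    refine (Real.exp_le_exp.2 h).trans ?_
    rw [Real.exp_add]
    refine mul_le_mul_of_nonneg_left ?_ (Real.exp_pos _).le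
    exact Finset.single_le_sum (f := fun m => Real.exp (∑ i, ((m * x i / Δ
      + Real.sqrt (q / Δ) * z i) * σ i - q / Δ * σ i ^ 2 / 2) - n * (m ^ 2 / (2 * Δ))))
      (fun _ _ => (Real.exp_pos _).le) hm
  have hpos := sum_mul_exp_pos (fun σ _ => condWeight_nonneg Δ x σ) (sum_condWeight_pos hs Δ x)
    (gfield (fun (σ : Fin n → ℝ) i => Real.sqrt (q / Δ) * σ i) (fun _ => 1) z)
  have hpos' := pos_of_mul_pos_right (hpos.trans_le hle) (Real.exp_pos _).le
  rw [lse]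
  refine (Real.log_le_log hpos hle).trans_eq ?_
  rw [Real.log_mul (Real.exp_pos _).ne' hpos'.ne', Real.log_exp]

end SpikedWigner

section Concentration
variable {Y : Type*} [MeasurableSpace Y] {ν : Measure Y} [IsProbabilityMeasure ν] {h : Y → ℝ}

theorem memLp_sum_eval (hh : MemLp h 2 ν) (n : ℕ) :
    MemLp (∑ i : Fin n, fun y : Fin n → Y => h (y i)) 2 (Measure.pi fun _ : Fin n => ν) :=
  memLp_finsetSum' _ fun i _ =>
    hh.comp_measurePreserving (measurePreserving_eval (fun _ : Fin n => ν) i)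

/-- An `L¹` law of large numbers with rate. -/
theorem integral_abs_sum_eval_sub_le (hh : MemLp h 2 ν) {n : ℕ} (hn : 0 < n) :
    ∫ y, |∑ i, h (y i) - n * ∫ x, h x ∂ν| ∂(Measure.pi fun _ : Fin n => ν)
      ≤ Real.sqrt n * ((1 + Var[h; ν]) / 2) := by
  obtain ⟨T, hT⟩ : ∃ T : (Fin n → Y) → ℝ, T = ∑ i : Fin n, fun y : Fin n → Y => h (y i) :=
    ⟨_, rfl⟩
  have hTL := memLp_sum_eval hh n
  rw [← hT] at hTL
  have hTy : ∀ y, T y = ∑ i, h (y i) := fun y => by simp [hT]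
  have hi : ∀ i : Fin n, Integrable (fun y : Fin n → Y => h (y i)) (Measure.pi fun _ => ν) :=
    fun i => (hh.comp_measurePreserving (measurePreserving_eval (fun _ : Fin n => ν) i)).integrable
      one_le_two
  have hET : ∫ y, T y ∂(Measure.pi fun _ : Fin n => ν) = n * ∫ x, h x ∂ν := by
    simp only [hTy]
    rw [integral_finsetSum _ fun i _ => hi i]
    simp [integral_comp_eval (μ := fun _ : Fin n => ν) hh.aestronglyMeasurable]
  have hvar : Var[T; Measure.pi fun _ : Fin n => ν] = n * Var[h; ν] := by
    rw [hT, variance_sum_pi (X := fun _ : Fin n => h) fun _ => hh]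
    simp
  rw [variance_eq_integral hTL.aestronglyMeasurable.aemeasurable, hET] at hvar
  simp only [← hTy]
  have hr : 0 < Real.sqrt n := Real.sqrt_pos.2 (by exact_mod_cast hn)
  have hD : MemLp (fun y => T y - n * ∫ x, h x ∂ν) 2 (Measure.pi fun _ : Fin n => ν) :=
    hTL.sub (memLp_const _)
  have hsq := hD.integrable_sq
  have hpt : ∀ D : ℝ, |D| ≤ Real.sqrt n / 2 + D ^ 2 / (2 * Real.sqrt n) := fun D => by
    have : Real.sqrt n / 2 + D ^ 2 / (2 * Real.sqrt n) - |D|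
        = (Real.sqrt n - |D|) ^ 2 / (2 * Real.sqrt n) := by
      rw [← sq_abs D]
      field_simp
      ring
    have h2 : 0 ≤ (Real.sqrt n - |D|) ^ 2 / (2 * Real.sqrt n) := by positivity
    linarith
  refine (integral_mono (hD.integrable one_le_two).abs
    ((integrable_const _).add (hsq.div_const _)) fun y => hpt _).trans_eq ?_
  simp only [Pi.add_apply]
  rw [integral_add (integrable_const _) (hsq.div_const _), integral_div, integral_div, hvar]
  simp only [integral_const, probReal_univ, smul_eq_mul, one_mul]
  have h3 : (n : ℝ) = Real.sqrt n * Real.sqrt n := (Real.mul_self_sqrt (Nat.cast_nonneg n)).symm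
  have h4 : (n : ℝ) * Var[h; ν] / (2 * Real.sqrt n) = Real.sqrt n * Var[h; ν] / 2 := by
    rw [div_eq_div_iff (by positivity) two_ne_zero]
    nth_rw 1 [h3]
    ring
  rw [h4]
  ring

theorem integrable_abs_sum_eval_sub (hh : MemLp h 2 ν) (n : ℕ) (c : ℝ) :
    Integrable (fun y : Fin n → Y => |∑ i, h (y i) - c|) (Measure.pi fun _ : Fin n => ν) := by
  have := (((memLp_sum_eval hh n).integrable one_le_two).sub (integrable_const c)).abs
  simpa using this

end Concentration

section LowerBound
variable {n : ℕ} {p : Measure ℝ} [IsProbabilityMeasure p] {s : Finset ℝ} {M Δ q : ℝ}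

theorem log_sum_exp_le {κ : Type*} {G : Finset κ} (hG : G.Nonempty) {T D : κ → ℝ} {c : ℝ}
    (hT : ∀ m ∈ G, T m ≤ c + |D m|) :
    Real.log (∑ m ∈ G, Real.exp (T m)) ≤ Real.log G.card + c + ∑ m ∈ G, |D m| := by
  have hpos : 0 < ∑ m ∈ G, Real.exp (T m) := Finset.sum_pos (fun _ _ => Real.exp_pos _) hG
  have hcard : (0 : ℝ) < G.card := by exact_mod_cast hG.card_pos
  have hle : ∑ m ∈ G, Real.exp (T m) ≤ G.card * Real.exp (c + ∑ m ∈ G, |D m|) := by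
    rw [← nsmul_eq_mul, ← Finset.sum_const]
    refine Finset.sum_le_sum fun m hm => Real.exp_le_exp.2 ((hT m hm).trans ?_)
    have := Finset.single_le_sum (f := fun m => |D m|) (fun _ _ => abs_nonneg _) hm
    linarith
  refine (Real.log_le_log hpos hle).trans_eq ?_
  rw [Real.log_mul hcard.ne' (Real.exp_pos _).ne', Real.log_exp, add_assoc]

/-- The free energy of a scalar channel conditioned on overlap `m`. -/
def scalarEnergy (p : Measure ℝ) (Δ q m : ℝ) (w : ℝ × ℝ) : ℝ :=
  Jf p (q / Δ) (m * w.1 / Δ + Real.sqrt (q / Δ) * w.2) - m ^ 2 / (2 * Δ)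

theorem ae_abs_Jf_channel_le (hs : p (↑s : Set ℝ)ᶜ = 0) (hM : ∀ x ∈ s, |x| ≤ M) (hM0 : 0 ≤ M)
    (hΔ : 0 < Δ) (m : ℝ) :
    ∀ᵐ w ∂(p.prod (gaussianReal 0 1)),
      |Jf p (q / Δ) (m * w.1 / Δ + Real.sqrt (q / Δ) * w.2)|
        ≤ M ^ 2 * |m| / Δ + |q / Δ| * M ^ 2 / 2 + M * Real.sqrt (q / Δ) * |w.2| := by
  filter_upwards [Measure.quasiMeasurePreserving_fst.ae (ae_mem_of_finset_support hs)] with w hw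
  refine (abs_Jf_le hs hM _ _).trans ?_
  have h1 : |m * w.1 / Δ + Real.sqrt (q / Δ) * w.2|
      ≤ |m| * M / Δ + Real.sqrt (q / Δ) * |w.2| := by
    refine (abs_add_le _ _).trans (add_le_add ?_ ?_)
    · rw [abs_div, abs_mul, abs_of_pos hΔ]
      have := hM _ hw
      gcongr
    · rw [abs_mul, abs_of_nonneg (Real.sqrt_nonneg _)]
  have h2 := mul_le_mul_of_nonneg_left h1 hM0
  have h3 : M * (|m| * M / Δ + Real.sqrt (q / Δ) * |w.2|)
      = M ^ 2 * |m| / Δ + M * Real.sqrt (q / Δ) * |w.2| := by ring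
  linarith

theorem memLp_snd_gaussian (a b : ℝ) :
    MemLp (fun w : ℝ × ℝ => a + b * |w.2|) 2 (p.prod (gaussianReal 0 1)) := by
  have h : MemLp (fun w : ℝ × ℝ => w.2) 2 (p.prod (gaussianReal 0 1)) :=
    (memLp_id_gaussianReal 2).comp_measurePreserving measurePreserving_snd
  exact (memLp_const a).add (h.abs.const_mul b)

theorem memLp_Jf_channel (hs : p (↑s : Set ℝ)ᶜ = 0) (hM : ∀ x ∈ s, |x| ≤ M) (hM0 : 0 ≤ M)
    (hΔ : 0 < Δ) (m : ℝ) :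
    MemLp (fun w : ℝ × ℝ => Jf p (q / Δ) (m * w.1 / Δ + Real.sqrt (q / Δ) * w.2)) 2
      (p.prod (gaussianReal 0 1)) :=
  (memLp_snd_gaussian _ _).mono' ((measurable_Jf hs _).comp (by fun_prop)).aestronglyMeasurable
    (ae_abs_Jf_channel_le hs hM hM0 hΔ m)

theorem memLp_scalarEnergy (hs : p (↑s : Set ℝ)ᶜ = 0) (hM : ∀ x ∈ s, |x| ≤ M) (hM0 : 0 ≤ M)
    (hΔ : 0 < Δ) (m : ℝ) : MemLp (scalarEnergy p Δ q m) 2 (p.prod (gaussianReal 0 1)) :=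
  (memLp_Jf_channel hs hM hM0 hΔ m).sub (memLp_const _)

theorem integral_scalarEnergy (hs : p (↑s : Set ℝ)ᶜ = 0) (hM : ∀ x ∈ s, |x| ≤ M) (hM0 : 0 ≤ M)
    (hΔ : 0 < Δ) (m : ℝ) :
    ∫ w, scalarEnergy p Δ q m w ∂(p.prod (gaussianReal 0 1))
      = ((∫ x, x ^ 2 ∂p) ^ 2 - q ^ 2) / (4 * Δ) - iL p Δ q m := by
  simp only [scalarEnergy]
  rw [integral_sub ((memLp_Jf_channel hs hM hM0 hΔ m).integrable one_le_two)
    (integrable_const _), iL]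
  simp only [integral_const, probReal_univ, smul_eq_mul, one_mul]
  field_simp
  ring

theorem bddBelow_iL (hs : p (↑s : Set ℝ)ᶜ = 0) (hM : ∀ x ∈ s, |x| ≤ M) (hM0 : 0 ≤ M)
    (hΔ : 0 < Δ) : BddBelow (Set.range fun m => iL p Δ q m) := by
  set C := ∫ w : ℝ × ℝ, (|q / Δ| * M ^ 2 / 2 + M * Real.sqrt (q / Δ) * |w.2|)
    ∂(p.prod (gaussianReal 0 1)) with hC
  refine ⟨-(q ^ 2 / (4 * Δ)) - M ^ 4 / (2 * Δ) - C, ?_⟩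
  rintro _ ⟨m, rfl⟩
  have hJ : ∫ w : ℝ × ℝ, Jf p (q / Δ) (m * w.1 / Δ + Real.sqrt (q / Δ) * w.2)
      ∂(p.prod (gaussianReal 0 1)) ≤ M ^ 2 * |m| / Δ + C := by
    have hi := (memLp_snd_gaussian (p := p) (|q / Δ| * M ^ 2 / 2)
      (M * Real.sqrt (q / Δ))).integrable one_le_two
    have h1 : M ^ 2 * |m| / Δ + C = ∫ w : ℝ × ℝ, (M ^ 2 * |m| / Δ
        + (|q / Δ| * M ^ 2 / 2 + M * Real.sqrt (q / Δ) * |w.2|)) ∂(p.prod (gaussianReal 0 1)) := by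
      rw [integral_add (integrable_const _) hi]
      simp [hC]
    rw [h1]
    refine integral_mono_ae ((memLp_Jf_channel hs hM hM0 hΔ m).integrable one_le_two)
      ((integrable_const _).add hi) ?_
    filter_upwards [ae_abs_Jf_channel_le (q := q) hs hM hM0 hΔ m] with w hw
    have := (le_abs_self _).trans hw
    linarith
  have h2 : (2 * m ^ 2 - q ^ 2 + (∫ x, x ^ 2 ∂p) ^ 2) / (4 * Δ) - M ^ 2 * |m| / Δ
      + q ^ 2 / (4 * Δ) + M ^ 4 / (2 * Δ)
      = (|m| - M ^ 2) ^ 2 / (2 * Δ) + (∫ x, x ^ 2 ∂p) ^ 2 / (4 * Δ) := by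
    rw [← sq_abs m]
    field_simp
    ring
  have h3 : 0 ≤ (|m| - M ^ 2) ^ 2 / (2 * Δ) + (∫ x, x ^ 2 ∂p) ^ 2 / (4 * Δ) := by positivity
  simp only [iL]
  linarith

theorem integrable_abs_overlapEnergy_sub (hs : p (↑s : Set ℝ)ᶜ = 0) (hM : ∀ x ∈ s, |x| ≤ M)
    (hM0 : 0 ≤ M) (hΔ : 0 < Δ) (m c : ℝ) :
    Integrable (fun w : (Fin n → ℝ) × (Fin n → ℝ) => |overlapEnergy p Δ q m w.1 w.2 - c|)
      ((Measure.pi fun _ : Fin n => p).prod (stdGauss (Fin n))) := by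
  have hmp := measurePreserving_arrowProdEquivProdArrow ℝ ℝ (Fin n) (fun _ => p)
    (fun _ => gaussianReal 0 1)
  rw [← hmp.integrable_comp_emb (MeasurableEquiv.measurableEmbedding _)]
  exact integrable_abs_sum_eval_sub (memLp_scalarEnergy hs hM hM0 hΔ m) n c

theorem integral_abs_overlapEnergy_sub_le (hn : 0 < n) (hs : p (↑s : Set ℝ)ᶜ = 0)
    (hM : ∀ x ∈ s, |x| ≤ M) (hM0 : 0 ≤ M) (hΔ : 0 < Δ) (m : ℝ) :
    ∫ x, ∫ z, |overlapEnergy p Δ q m x z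
        - n * ∫ w, scalarEnergy p Δ q m w ∂(p.prod (gaussianReal 0 1))| ∂(stdGauss (Fin n))
        ∂(Measure.pi fun _ : Fin n => p)
      ≤ Real.sqrt n * ((1 + Var[scalarEnergy p Δ q m; p.prod (gaussianReal 0 1)]) / 2) := by
  have hmp := measurePreserving_arrowProdEquivProdArrow ℝ ℝ (Fin n) (fun _ => p)
    (fun _ => gaussianReal 0 1)
  rw [← integral_prod (fun w : (Fin n → ℝ) × (Fin n → ℝ) => |overlapEnergy p Δ q m w.1 w.2
    - n * ∫ w, scalarEnergy p Δ q m w ∂(p.prod (gaussianReal 0 1))|)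
    (integrable_abs_overlapEnergy_sub hs hM hM0 hΔ m _), ← hmp.integral_comp']
  exact integral_abs_sum_eval_sub_le (memLp_scalarEnergy hs hM hM0 hΔ m) hn

theorem le_sum_spikeMean_sq (hn : 0 < n) (hΔ : 0 < Δ) (ρ : ℝ) (x : Fin n → ℝ) :
    ρ / (2 * Δ) * ∑ i, x i ^ 2 - n * ρ ^ 2 / (4 * Δ) ≤ ∑ a, spikeMean n x a ^ 2 / (2 * Δ) := by
  have hn' : (0 : ℝ) < n := by exact_mod_cast hn
  have h := sum_spikeMean_mul x x
  simp only [← pow_two] at h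
  rw [← Finset.sum_div, h]
  have hU : 0 ≤ ∑ i, (x i ^ 2) ^ 2 := Finset.sum_nonneg fun _ _ => sq_nonneg _
  set R := ∑ i, x i ^ 2
  set U := ∑ i, (x i ^ 2) ^ 2
  have h1 : (R ^ 2 + U) / (2 * n) / (2 * Δ) - (ρ / (2 * Δ) * R - n * ρ ^ 2 / (4 * Δ))
      = ((R - n * ρ) ^ 2 + U) / (4 * n * Δ) := by
    field_simp
    ring
  have h2 : 0 ≤ ((R - n * ρ) ^ 2 + U) / (4 * n * Δ) := by positivity
  linarith

/-- Nonasymptotic lower bound on the mutual information. -/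
theorem le_MI (hn : 0 < n) (hs : p (↑s : Set ℝ)ᶜ = 0) (hM : ∀ x ∈ s, |x| ≤ M) (hM0 : 0 ≤ M)
    (hΔ : 0 < Δ) (hq : 0 ≤ q) {G : Finset ℝ} (hGne : G.Nonempty) {ε : ℝ}
    (hG : ∀ r : ℝ, |r| ≤ M ^ 2 → ∃ m ∈ G, |r - m| ≤ ε) {I : ℝ} (hI : ∀ m, I ≤ iL p Δ q m) :
    n * I - n * ε ^ 2 / (2 * Δ) - M ^ 4 / (2 * Δ) - Real.log G.card
      - Real.sqrt n * ∑ m ∈ G, (1 + Var[scalarEnergy p Δ q m; p.prod (gaussianReal 0 1)]) / 2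
      ≤ MI p Δ n := by
  set P := Measure.pi fun _ : Fin n => p with hP
  have hPs : P (↑(Fintype.piFinset fun _ : Fin n => s) : Set (Fin n → ℝ))ᶜ = 0 :=
    pi_finset_support hs
  set ρ := ∫ x, x ^ 2 ∂p with hρ
  set c := (ρ ^ 2 - q ^ 2) / (4 * Δ) - I with hc
  set D : ℝ → (Fin n → ℝ) → (Fin n → ℝ) → ℝ := fun m x z => overlapEnergy p Δ q m x z
    - n * ∫ w, scalarEnergy p Δ q m w ∂(p.prod (gaussianReal 0 1)) with hD
  have hDint : ∀ m, ∀ᵐ x ∂P, Integrable (fun z => |D m x z|) (stdGauss (Fin n)) := fun m =>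
    (integrable_abs_overlapEnergy_sub hs hM hM0 hΔ m _).prod_right_ae
  set K := M ^ 4 / (2 * Δ) + n * ε ^ 2 / (2 * Δ) + Real.log G.card + n * c
    + n * q ^ 2 / (2 * Δ) / 2 with hK
  have hpt : ∀ᵐ x ∂P, ρ / (2 * Δ) * ∑ i, x i ^ 2 - n * ρ ^ 2 / (4 * Δ) - K
        - ∑ m ∈ G, ∫ z, |D m x z| ∂(stdGauss (Fin n))
      ≤ ∑ a, spikeMean n x a ^ 2 / (2 * Δ)
        - ∫ ξ, lse (Fintype.piFinset fun _ : Fin n => s) (condWeight p Δ x)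
          (gfield (obsField Δ) (fun _ => 1) ξ) ∂(stdGauss (SymIdx n)) := by
    filter_upwards [ae_mem_of_finset_support hPs, (Finset.eventually_all G).2 fun m _ => hDint m]
      with x hx hDx
    have hx' := Fintype.mem_piFinset.1 hx
    have hcmp := integral_lse_obsField_le hn hΔ hq (fun σ _ => condWeight_nonneg Δ x σ)
      (sum_condWeight_pos hs Δ x)
    obtain ⟨L, hL⟩ := exists_abs_le_of_finset (Fintype.piFinset fun _ : Fin n => s)
      (fun (σ : Fin n → ℝ) i => Real.sqrt (q / Δ) * σ i)
    have hscal : ∫ z, lse (Fintype.piFinset fun _ : Fin n => s) (condWeight p Δ x)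
        (gfield (fun σ i => Real.sqrt (q / Δ) * σ i) (fun _ => 1) z) ∂(stdGauss (Fin n))
        ≤ ∫ z, (M ^ 4 / (2 * Δ) + n * ε ^ 2 / (2 * Δ) + Real.log G.card + n * c
          + ∑ m ∈ G, |D m x z|) ∂(stdGauss (Fin n)) := by
      refine integral_mono (integrable_lse_gfield (fun σ _ => condWeight_nonneg Δ x σ)
        (sum_condWeight_pos hs Δ x) hL fun _ => by simp)
        ((integrable_const _).add (integrable_finsetSum _ hDx)) fun z => ?_
      have h1 := lse_condWeight_le hn hs hM hΔ hq hG hx' z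
      have h2 := log_sum_exp_le hGne (T := fun m => overlapEnergy p Δ q m x z)
        (D := fun m => D m x z) (c := n * c) fun m _ => by
          have h3 := le_abs_self (D m x z)
          have h4 : n * ∫ w, scalarEnergy p Δ q m w ∂(p.prod (gaussianReal 0 1)) ≤ n * c := by
            refine mul_le_mul_of_nonneg_left ?_ (Nat.cast_nonneg n)
            rw [integral_scalarEnergy hs hM hM0 hΔ]
            linarith [hI m]
          simp only [hD] at h3 ⊢
          linarith
      beta_reduce
      linarith
    rw [integral_add (integrable_const _) (integrable_finsetSum _ hDx),
      integral_finsetSum _ hDx] at hscal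
    simp only [integral_const, probReal_univ, smul_eq_mul, one_mul] at hscal
    have := le_sum_spikeMean_sq hn hΔ ρ x
    rw [hK]
    linarith
  rw [MI_eq hs hΔ]
  refine le_trans ?_ (integral_mono_ae (integrable_of_finset_support hPs _)
    (integrable_of_finset_support hPs _) hpt)
  have hsq : ∫ x, ∑ i, x i ^ 2 ∂P = n * ρ := by
    rw [integral_finsetSum _ fun i _ => integrable_of_finset_support hPs _]
    simp [hP, integral_comp_eval (μ := fun _ : Fin n => p) (f := fun x : ℝ => x ^ 2)
      (by fun_prop), hρ]
  have hsum := Finset.sum_le_sum fun m (_ : m ∈ G) =>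
    integral_abs_overlapEnergy_sub_le (q := q) hn hs hM hM0 hΔ m
  rw [← Finset.mul_sum] at hsum
  rw [integral_sub (integrable_of_finset_support hPs _) (integrable_of_finset_support hPs _),
    integral_sub (integrable_of_finset_support hPs _) (integrable_of_finset_support hPs _),
    integral_sub (integrable_of_finset_support hPs _) (integrable_of_finset_support hPs _),
    integral_const_mul, hsq,
    integral_finsetSum _ fun m _ => integrable_of_finset_support hPs _]
  simp only [integral_const, probReal_univ, smul_eq_mul, one_mul]
  have hfinal : ρ / (2 * Δ) * (n * ρ) - n * ρ ^ 2 / (4 * Δ) - K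
      = n * I - n * ε ^ 2 / (2 * Δ) - M ^ 4 / (2 * Δ) - Real.log G.card := by
    rw [hK, hc]
    field_simp
    ring
  linarith

end LowerBound

section UpperBound
variable {n : ℕ} {p : Measure ℝ} {s : Finset ℝ} {M Δ : ℝ}

theorem abs_sum_spikeMean_mul_le (hn : 0 < n) (hM : ∀ x ∈ s, |x| ≤ M) {x y : Fin n → ℝ}
    (hx : ∀ i, x i ∈ s) (hy : ∀ i, y i ∈ s) :
    |∑ a, spikeMean n x a * spikeMean n y a| ≤ n * M ^ 4 := by
  have hn' : (1 : ℝ) ≤ n := by exact_mod_cast hn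
  have hprod : ∀ i, |x i * y i| ≤ M ^ 2 := fun i => by
    rw [abs_mul, pow_two]
    exact mul_le_mul (hM _ (hx i)) (hM _ (hy i)) (abs_nonneg _)
      ((abs_nonneg _).trans (hM _ (hx i)))
  have hR : |∑ i, x i * y i| ≤ n * M ^ 2 :=
    (Finset.abs_sum_le_sum_abs _ _).trans ((Finset.sum_le_sum fun i _ => hprod i).trans_eq (by simp))
  have hU : ∑ i, (x i * y i) ^ 2 ≤ n * M ^ 4 := by
    refine (Finset.sum_le_sum (g := fun _ => M ^ 4) fun i _ => ?_).trans_eq (by simp)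
    rw [← sq_abs, show M ^ 4 = (M ^ 2) ^ 2 by ring]
    exact pow_le_pow_left₀ (abs_nonneg _) (hprod i) 2
  have hR2 : (∑ i, x i * y i) ^ 2 ≤ (n * M ^ 2) ^ 2 := by
    rw [← sq_abs]
    exact pow_le_pow_left₀ (abs_nonneg _) hR 2
  have hU0 : 0 ≤ ∑ i, (x i * y i) ^ 2 := Finset.sum_nonneg fun _ _ => sq_nonneg _
  have hM4 : 0 ≤ M ^ 4 := by positivity
  rw [sum_spikeMean_mul, abs_of_nonneg (by positivity), div_le_iff₀ (by positivity)]
  nlinarith [mul_le_mul_of_nonneg_right hn' (mul_nonneg (Nat.cast_nonneg (α := ℝ) n) hM4)]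

variable [IsProbabilityMeasure p]

/-- The mutual information grows at most linearly. -/
theorem MI_le (hn : 0 < n) (hs : p (↑s : Set ℝ)ᶜ = 0) (hM : ∀ x ∈ s, |x| ≤ M) (hΔ : 0 < Δ) :
    MI p Δ n ≤ n * (2 * M ^ 4 / Δ) := by
  set P := Measure.pi fun _ : Fin n => p with hP
  have hPs : P (↑(Fintype.piFinset fun _ : Fin n => s) : Set (Fin n → ℝ))ᶜ = 0 :=
    pi_finset_support hs
  have hsum := sum_real_singleton_of_finset_support hPs
  rw [MI_eq hs hΔ]
  refine (integral_mono_ae (g := fun _ => n * (2 * M ^ 4 / Δ))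
    (integrable_of_finset_support hPs _) (integrable_const _) ?_).trans_eq (by simp)
  filter_upwards [ae_mem_of_finset_support hPs] with x hx
  have hx' := Fintype.mem_piFinset.1 hx
  have hcmp := integral_lse_gfield_le (fun σ _ => condWeight_nonneg Δ x σ)
    (sum_condWeight_pos hs Δ x) (fun (_ : Fin n → ℝ) (_ : Empty) => (0 : ℝ)) (obsField Δ)
    (K := n * M ^ 4 / Δ) fun σ hσ τ hτ => by
      have h := (le_abs_self _).trans (abs_sum_spikeMean_mul_le hn hM
        (Fintype.mem_piFinset.1 hσ) (Fintype.mem_piFinset.1 hτ))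
      rw [sum_spikeMean_mul] at h
      rw [sum_obsField_mul hΔ, ← div_div]
      simp only [Finset.univ_eq_empty, Finset.sum_empty, zero_add]
      gcongr
  have hlse := abs_lse_le (w := fun σ => P.real {σ}) (E := fun σ =>
      ∑ a, spikeMean n σ a * spikeMean n x a / Δ + 0) (B := n * M ^ 4 / Δ)
    (fun σ _ => measureReal_nonneg) (by rw [hsum]; exact one_pos) fun σ hσ => by
      rw [add_zero, ← Finset.sum_div, abs_div, abs_of_pos hΔ]
      have := abs_sum_spikeMean_mul_le hn hM (Fintype.mem_piFinset.1 hσ) hx'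
      gcongr
  rw [← lse_mul_exp _ _ _ fun _ => 0, hsum] at hlse
  have hempty : ∀ g : Empty → ℝ, gfield (fun (_ : Fin n → ℝ) (_ : Empty) => (0 : ℝ))
      (fun _ => 1) g = fun _ => 0 := fun g => by
    funext σ
    simp [gfield]
  simp only [hempty, integral_const, probReal_univ, smul_eq_mul, one_mul] at hcmp
  simp only [Real.log_one, abs_zero, zero_add] at hlse
  have hlow := (abs_le.1 hlse).1
  have hself := (le_abs_self _).trans (abs_sum_spikeMean_mul_le hn hM hx' hx')
  simp only [← pow_two] at hself
  have hself' : ∑ a, spikeMean n x a ^ 2 / (2 * Δ) ≤ n * M ^ 4 / (2 * Δ) := by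
    rw [← Finset.sum_div]
    gcongr
  have hc : (n : ℝ) * (2 * M ^ 4 / Δ)
      = n * M ^ 4 / (2 * Δ) + n * M ^ 4 / Δ + n * M ^ 4 / Δ / 2 := by
    field_simp
    ring
  change -(n * M ^ 4 / Δ) ≤ lse _ (condWeight p Δ x) _ at hlow
  linarith

end UpperBound

theorem exists_finset_net (R : ℝ) (hR : 0 ≤ R) {ε : ℝ} (hε : 0 < ε) :
    ∃ G : Finset ℝ, G.Nonempty ∧ ∀ r : ℝ, |r| ≤ R → ∃ m ∈ G, |r - m| ≤ ε := by
  obtain ⟨t, -, ht, hcov⟩ := (isCompact_Icc (a := -R) (b := R)).finite_cover_balls hε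
  have h : ∀ r : ℝ, |r| ≤ R → ∃ m ∈ ht.toFinset, |r - m| ≤ ε := fun r hr => by
    obtain ⟨m, hm, hrm⟩ := Set.mem_iUnion₂.1 (hcov (abs_le.1 hr))
    exact ⟨m, ht.mem_toFinset.2 hm, (Metric.mem_ball.1 hrm).le⟩
  obtain ⟨m, hm, -⟩ := h 0 (by simpa)
  exact ⟨_, ⟨m, hm⟩, h⟩

/-- **Lower bound** : `liminf_{n→∞} I(x*;Y)/n ≥ inf_{m∈ℝ} i_L(m)`. -/
theorem lower_bound (p : Measure ℝ) [IsProbabilityMeasure p]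
    (hsupp : ∃ s : Finset ℝ, p (↑s : Set ℝ)ᶜ = 0)
    (Δ : ℝ) (hΔ : 0 < Δ) (mhat : ℝ) (hmhat : 0 ≤ mhat)
    (hmin : ∀ m : ℝ, 0 ≤ m → iB p Δ mhat ≤ iB p Δ m)
    (hfin : {m : ℝ | deriv (iL p Δ mhat) m = 0}.Finite) :
    ⨅ m : ℝ, iL p Δ mhat m ≤ liminf (fun n : ℕ => MI p Δ n / n) atTop := by
  obtain ⟨s, hs⟩ := hsupp
  obtain ⟨M, hM0, hM⟩ : ∃ M : ℝ, 0 ≤ M ∧ ∀ x ∈ s, |x| ≤ M :=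
    ⟨∑ x ∈ s, |x|, Finset.sum_nonneg fun _ _ => abs_nonneg _, fun x hx =>
      Finset.single_le_sum (f := fun x : ℝ => |x|) (fun _ _ => abs_nonneg _) hx⟩
  have hI : ∀ m, ⨅ m, iL p Δ mhat m ≤ iL p Δ mhat m := ciInf_le (bddBelow_iL hs hM hM0 hΔ)
  set I := ⨅ m, iL p Δ mhat m
  have hcob : IsCoboundedUnder (· ≥ ·) atTop fun n : ℕ => MI p Δ n / n := by
    refine IsBoundedUnder.isCoboundedUnder_ge ⟨2 * M ^ 4 / Δ, ?_⟩
    rw [eventually_map]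
    filter_upwards [eventually_gt_atTop 0] with n hn
    rw [div_le_iff₀' (by exact_mod_cast hn)]
    exact MI_le hn hs hM hΔ
  refine le_of_forall_pos_le_add fun δ hδ => ?_
  rw [← sub_le_iff_le_add]
  refine le_liminf_of_le hcob ?_
  obtain ⟨G, hGne, hG⟩ := exists_finset_net (M ^ 2) (sq_nonneg M)
    (Real.sqrt_pos.2 (mul_pos hΔ hδ))
  set C := M ^ 4 / (2 * Δ) + Real.log G.card
  set V := ∑ m ∈ G, (1 + Var[scalarEnergy p Δ mhat m; p.prod (gaussianReal 0 1)]) / 2 with hV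
  have hlim : Tendsto (fun n : ℕ => C / (n : ℝ) + V / Real.sqrt n) atTop (nhds 0) := by
    have h1 := tendsto_const_div_atTop_nhds_zero_nat C
    have h2 : Tendsto (fun n : ℕ => V / Real.sqrt n) atTop (nhds 0) :=
      (Real.tendsto_sqrt_atTop.comp tendsto_natCast_atTop_atTop).const_div_atTop V
    simpa using h1.add h2
  filter_upwards [eventually_gt_atTop 0, hlim.eventually (gt_mem_nhds (half_pos hδ))] with n hn hlt
  have hn' : (0 : ℝ) < n := by exact_mod_cast hn
  have h := le_MI hn hs hM hM0 hΔ hmhat hGne hG hI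
  rw [Real.sq_sqrt (mul_pos hΔ hδ).le, ← hV] at h
  rw [le_div_iff₀ hn']
  have hr : 0 < Real.sqrt n := Real.sqrt_pos.2 hn'
  have h3 : (C / n + V / Real.sqrt n) * n = C + Real.sqrt n * V := by
    have h4 : V / Real.sqrt n * n = Real.sqrt n * V := by
      nth_rw 2 [← Real.mul_self_sqrt hn'.le]
      field_simp
    rw [add_mul, h4, div_mul_cancel₀ _ hn'.ne']
  have h5 := mul_lt_mul_of_pos_right hlt hn'
  rw [h3] at h5
  have h6 : n * (Δ * δ) / (2 * Δ) = δ / 2 * n := by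
    field_simp
  have h7 : (I - δ) * n = n * I - δ / 2 * n - δ / 2 * n := by ring
  linarith
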